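/- If M is a countable transitive set such that (M,∈) satisfies all axioms of ZF, then there exists a countable transitive set N with M ⊆ N and M ≠ N (a proper extension), containing exactly the same ordinals as M, such that (N,∈) satisfies ZF; moreover, if (M,∈) additionally satisfies AC, then (N,∈) satisfies AC. -/

import Mathlib

namespace CtmForcing

open FirstOrder FirstOrder.Language

/-! ### The first-order language of set theory -/

/-- The relation symbols of the language of set theory: a single binary relation `∈`. -/
inductive memRel : ℕ → Type
  | mem : memRel 2

/-- The first-order language `L` of set theory, with a single binary relation symbol `∈`. -/
def SetLang : Language := ⟨fun _ => Empty, memRel⟩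

/-- The membership relation symbol. -/
abbrev memSymb : SetLang.Relations 2 := .mem

/-- `L`-formulas (with no free "unbounded" variables) whose free variables are among
`v₀, …, v_{n-1}`. -/
abbrev BF (n : ℕ) := SetLang.BoundedFormula Empty n

/-- The atomic formula `vᵢ ∈ vⱼ`. -/
def memf {n : ℕ} (i j : Fin n) : BF n :=
  memSymb.boundedFormula₂ (Term.var (Sum.inr i)) (Term.var (Sum.inr j))

/-- The atomic formula `vᵢ = vⱼ`. -/
def eqf {n : ℕ} (i j : Fin n) : BF n :=
  Term.bdEqual (Term.var (Sum.inr i)) (Term.var (Sum.inr j))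

/-- Rename the free variables of a formula along `f`. -/
def reindex {m k : ℕ} (f : Fin m → Fin k) (φ : BF m) : BF k :=
  (BoundedFormula.relabel (Sum.map id f) φ.toFormula : SetLang.BoundedFormula Empty (k + 0))

/-- Conjunction. -/
def andF {n : ℕ} (φ ψ : BF n) : BF n := (φ.imp ψ.not).not

/-- Disjunction. -/
def orF {n : ℕ} (φ ψ : BF n) : BF n := (φ.not).imp ψ

/-- Biimplication. -/
def iffF {n : ℕ} (φ ψ : BF n) : BF n := andF (φ.imp ψ) (ψ.imp φ)

/-! ### Basic set-theoretic formulas -/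

/-- `v₀ ⊆ v₁`. -/
def subF : BF 2 := ((memf 2 0).imp (memf 2 1)).all

/-- `v₀ = ∅`. -/
def emptyF : BF 1 := ((memf 1 0).not).all

/-- `v₂ = {v₀, v₁}`. -/
def pairSetF : BF 3 := (iffF (memf 3 2) (orF (eqf 3 0) (eqf 3 1))).all

/-- `v₁ = {v₀}`. -/
def singF : BF 2 := reindex ![0, 0, 1] pairSetF

/-- `v₂ = ⟨v₀, v₁⟩` (Kuratowski ordered pair). -/
def opF : BF 3 :=
  (iffF (memf 3 2) (orF (reindex ![0, 3] singF) (reindex ![0, 1, 3] pairSetF))).all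

/-- `v₁ = v₀ ∪ {v₀}`. -/
def succF : BF 2 := (iffF (memf 2 1) (orF (memf 2 0) (eqf 2 0))).all

/-- `v₀` is transitive. -/
def transF : BF 1 := ((memf 1 0).imp (reindex ![1, 0] subF)).all

/-- `v₀` is an ordinal (a transitive set of transitive sets). -/
def ordF : BF 1 := andF transF (((memf 1 0).imp (reindex ![1] transF)).all)

/-- `⟨v₀, v₁⟩ ∈ v₂`. -/
def relMemF : BF 3 := (andF (reindex ![0, 1, 3] opF) (memf 3 2)).ex

/-- `v₂` is a function with domain `v₀` mapping onto `v₁` (a surjection from `v₀` onto `v₁`). -/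
def isFuncF : BF 3 :=
  andF
    (andF
      -- v₂ ⊆ v₀ × v₁
      (((memf 3 2).imp
        (((andF (andF (memf 4 0) (memf 5 1)) (reindex ![4, 5, 3] opF)).ex).ex)).all)
      -- total on v₀
      (((memf 3 0).imp ((andF (memf 4 1) (reindex ![3, 4, 2] relMemF)).ex)).all))
    (andF
      -- functional
      ((((andF (reindex ![3, 4, 2] relMemF) (reindex ![3, 5, 2] relMemF)).imp
          (eqf 4 5)).all).all.all)
      -- onto v₁
      (((memf 3 1).imp ((andF (memf 4 0) (reindex ![4, 3, 2] relMemF)).ex)).all))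

/-- `v₂` is injective (as a set of ordered pairs). -/
def injF : BF 3 :=
  ((((andF (reindex ![3, 5, 2] relMemF) (reindex ![4, 5, 2] relMemF)).imp
      (eqf 3 4)).all).all).all

/-- `v₂` is a bijection from `v₀` onto `v₁`. -/
def bijF : BF 3 := andF isFuncF injF

/-! ### The axioms of set theory as `L`-sentences -/

/-- Extensionality. -/
def extAx : SetLang.Sentence :=
  ((((andF subF (reindex ![1, 0] subF)).imp (eqf 0 1)).all).all : BF 0)

/-- Foundation. -/
def foundAx : SetLang.Sentence :=
  (((((memf 1 0).ex).imp
    ((andF (memf 1 0) (((memf 2 0).imp ((memf 2 1).not)).all)).ex)).all) : BF 0)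

/-- Pairing. -/
def pairAx : SetLang.Sentence := (((pairSetF.ex).all).all : BF 0)

/-- Union. -/
def unionAx : SetLang.Sentence :=
  (((((iffF (memf 2 1) ((andF (memf 3 0) (memf 2 3)).ex)).all).ex).all : BF 0))

/-- Powerset. -/
def powF : BF 2 := (iffF (memf 2 1) (reindex ![2, 0] subF)).all

/-- Powerset axiom. -/
def powAx : SetLang.Sentence := (((powF.ex).all) : BF 0)

/-- Infinity. -/
def infAx : SetLang.Sentence :=
  (((andF ((andF (memf 1 0) (reindex ![1] emptyF)).ex)
    (((memf 1 0).imp ((andF (memf 2 0) (reindex ![1, 2] succF)).ex)).all)).ex) : BF 0)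

/-- The instance of the Separation scheme given by `φ`, whose free variables are among
`v₀, …, vₙ`: the parameters are `v₀, …, v_{n-1}` and the tested element is `vₙ`.  It is the
universal closure of `∀A ∃B ∀x (x ∈ B ↔ x ∈ A ∧ φ(params, x))`. -/
def sepAx {n : ℕ} (φ : BF (n + 1)) : SetLang.Sentence :=
  -- context `n+3`: parameters `0,…,n-1`, `A = n`, `B = n+1`, `x = n+2`
  let A : Fin (n + 3) := ⟨n, by omega⟩
  let B : Fin (n + 3) := ⟨n + 1, by omega⟩
  let x : Fin (n + 3) := ⟨n + 2, by omega⟩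
  let φ' : BF (n + 3) := reindex (fun i => if h : (i : ℕ) < n then ⟨i, by omega⟩ else x) φ
  ((((iffF (memf x B) (andF (memf x A) φ')).all).ex).all).alls

/-- The instance of the Replacement scheme given by `φ`, whose free variables are among
`v₀, …, v_{n+1}`: the parameters are `v₀, …, v_{n-1}`, the argument is `x = vₙ`, and the
value is `y = v_{n+1}`.  It is the universal closure of
`∀A [(∀x∈A ∀y ∀y' (φ(x,y) ∧ φ(x,y') → y = y')) → ∃B ∀y (y ∈ B ↔ ∃x∈A φ(x,y))]`. -/
def replAx {n : ℕ} (φ : BF (n + 2)) : SetLang.Sentence :=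
  -- functionality context `n+4`: parameters, `A = n`, `x = n+1`, `y = n+2`, `y' = n+3`
  let A : Fin (n + 4) := ⟨n, by omega⟩
  let x : Fin (n + 4) := ⟨n + 1, by omega⟩
  let y : Fin (n + 4) := ⟨n + 2, by omega⟩
  let y' : Fin (n + 4) := ⟨n + 3, by omega⟩
  let φ₁ : BF (n + 4) :=
    reindex (fun i => if h : (i : ℕ) < n then ⟨i, by omega⟩ else if (i : ℕ) = n then x else y) φ
  let φ₂ : BF (n + 4) :=
    reindex (fun i => if h : (i : ℕ) < n then ⟨i, by omega⟩ else if (i : ℕ) = n then x else y') φ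
  let funcl : BF (n + 1) :=
    ((((andF (memf x A) (andF φ₁ φ₂)).imp (eqf y y')).all).all).all
  -- image context `n+4`: parameters, `A = n`, `B = n+1`, `y = n+2`, `x = n+3`
  let xi : Fin (n + 4) := ⟨n + 3, by omega⟩
  let yi : Fin (n + 4) := ⟨n + 2, by omega⟩
  let B3 : Fin (n + 3) := ⟨n + 1, by omega⟩
  let y3 : Fin (n + 3) := ⟨n + 2, by omega⟩
  let φ₃ : BF (n + 4) :=
    reindex (fun i => if h : (i : ℕ) < n then ⟨i, by omega⟩ else if (i : ℕ) = n then xi else yi) φ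
  let image : BF (n + 1) :=
    (((iffF (memf y3 B3) ((andF (memf xi A) φ₃).ex)).all).ex)
  ((funcl.imp image).all).alls

/-- The Axiom of Choice: every set is the surjective image of an ordinal. -/
def acAx : SetLang.Sentence :=
  ((((andF (reindex ![1] ordF) (reindex ![1, 0, 2] isFuncF)).ex).ex).all : BF 0)

/-- `v₀ = ω`: `v₀` is an ordinal containing `∅`, closed under successors, each of whose
elements is `∅` or a successor. -/
def omegaF : BF 1 :=
  andF (andF ordF ((andF (memf 1 0) (reindex ![1] emptyF)).ex))
    (andF (((memf 1 0).imp ((andF (memf 2 0) (reindex ![1, 2] succF)).ex)).all)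
      (((memf 1 0).imp
        (orF (reindex ![1] emptyF) ((andF (memf 2 1) (reindex ![2, 1] succF)).ex))).all))

/-- Given `v₀ = ω`, `v₁ = ℵ₁`: `v₁` is an ordinal, there is no surjection from `ω` onto `v₁`,
and every element of `v₁` is empty or a surjective image of `ω`. -/
def alephOneF : BF 2 :=
  andF (andF (reindex ![1] ordF) (((reindex ![0, 1, 2] isFuncF).ex).not))
    (((memf 2 1).imp (orF (reindex ![2] emptyF) ((reindex ![0, 2, 3] isFuncF).ex))).all)

/-- The Continuum Hypothesis `ℵ₁ = 2^ℵ₀`: there is a bijection between `𝒫(ω)` and `ℵ₁`. -/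
def chSent : SetLang.Sentence :=
  (((((andF (andF (reindex ![0] omegaF) (reindex ![0, 1] powF))
      (andF (reindex ![0, 2] alephOneF) (reindex ![1, 2, 3] bijF))).ex).ex).ex).ex : BF 0)

/-! ### The theories `Z`, `ZF`, `ZC`, `ZFC` -/

/-- The finitely many non-scheme axioms of `ZF`. -/
def zfFin : SetLang.Theory := {extAx, foundAx, pairAx, unionAx, powAx, infAx}

/-- All instances of the Separation scheme. -/
def sepScheme : SetLang.Theory := Set.range fun p : Σ n, BF (n + 1) => sepAx p.2

/-- All instances of the Replacement scheme. -/
def replScheme : SetLang.Theory := Set.range fun p : Σ n, BF (n + 2) => replAx p.2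

/-- Zermelo set theory. -/
def Z : SetLang.Theory := zfFin ∪ sepScheme

/-- Zermelo–Fraenkel set theory. -/
def ZF : SetLang.Theory := Z ∪ replScheme

/-- Zermelo set theory with Choice. -/
def ZC : SetLang.Theory := Z ∪ {acAx}

/-- Zermelo–Fraenkel set theory with Choice. -/
def ZFC : SetLang.Theory := ZF ∪ {acAx}

/-! ### Satisfaction in a set with the true membership relation -/

/-- The `L`-structure on (the elements of) a `ZFSet` `M`, with `∈` interpreted as true
membership. -/
def zfStruct (M : ZFSet) : SetLang.Structure {x : ZFSet // x ∈ M} where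
  funMap := fun f _ => f.elim
  RelMap | .mem => fun v => ((v 0 : {x : ZFSet // x ∈ M}) : ZFSet) ∈ ((v 1 : {x : ZFSet // x ∈ M}) : ZFSet)

/-- `(M, ∈) ⊨ T`: the structure on `M` with true membership satisfies every sentence of `T`. -/
def ZModels (M : ZFSet) (T : SetLang.Theory) : Prop :=
  ∀ φ ∈ T, letI := zfStruct M; Sentence.Realize (M := {x : ZFSet // x ∈ M}) φ

/-- `(M, ∈) ⊨ φ[v₀, …, v_{k-1}]`: satisfaction of the formula `φ` in `M`, with the
(membership-checked) valuation `v` of its free variables. -/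
def ZRealize (M : ZFSet) {k : ℕ} (φ : BF k) (v : Fin k → ZFSet) : Prop :=
  ∀ h : ∀ i, v i ∈ M,
    letI := zfStruct M
    BoundedFormula.Realize (M := {x : ZFSet // x ∈ M}) φ (fun e => e.elim) (fun i => ⟨v i, h i⟩)

/-- `x` is a (von Neumann) ordinal: a transitive set of transitive sets. -/
def IsOrd (x : ZFSet) : Prop := x.IsTransitive ∧ ∀ y ∈ x, ZFSet.IsTransitive y

end CtmForcing

namespace CtmForcing
open FirstOrder FirstOrder.Language

section Basics
variable {W : Type*} [SetLang.Structure W]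

/-- membership of the structure -/
def Mm (x y : W) : Prop := Structure.RelMap memSymb ![x, y]
infix:50 " ∊ " => Mm

theorem realize_memf {n} (i j : Fin n) (e : Empty → W) (v : Fin n → W) :
    (memf i j).Realize e v ↔ v i ∊ v j := by
  simp [memf, Mm, BoundedFormula.realize_rel₂]

theorem realize_eqf {n} (i j : Fin n) (e : Empty → W) (v : Fin n → W) :
    (eqf i j).Realize e v ↔ v i = v j := by
  simp [eqf]

theorem realize_reindex {m k} (f : Fin m → Fin k) (φ : BF m) (e : Empty → W) (v : Fin k → W) :
    (reindex f φ).Realize e v ↔ φ.Realize e (fun i => v (f i)) := by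
  have h := @BoundedFormula.realize_relabel SetLang W _ (Empty ⊕ Fin m) Empty k 0 φ.toFormula
    (Sum.map id f : Empty ⊕ Fin m → Empty ⊕ Fin k) e v
  have h2 := BoundedFormula.realize_toFormula (L := SetLang) φ
    (Sum.elim e (v ∘ Fin.castAdd 0) ∘ Sum.map id f)
  unfold reindex
  refine h.trans ?_
  have : (v ∘ Fin.natAdd k : Fin 0 → W) = default := Subsingleton.elim _ _
  rw [this]
  refine h2.trans ?_
  have e1 : ((Sum.elim e (v ∘ Fin.castAdd 0) ∘ Sum.map id f) ∘ Sum.inl) = e := by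
    funext x; exact x.elim
  rw [e1]; exact Iff.rfl

theorem realize_andF {n} (φ ψ : BF n) (e : Empty → W) (v : Fin n → W) :
    (andF φ ψ).Realize e v ↔ φ.Realize e v ∧ ψ.Realize e v := by
  simp [andF]

theorem realize_orF {n} (φ ψ : BF n) (e : Empty → W) (v : Fin n → W) :
    (orF φ ψ).Realize e v ↔ φ.Realize e v ∨ ψ.Realize e v := by
  simp [orF]; tauto

theorem realize_iffF {n} (φ ψ : BF n) (e : Empty → W) (v : Fin n → W) :
    (iffF φ ψ).Realize e v ↔ (φ.Realize e v ↔ ψ.Realize e v) := by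
  simp [iffF, realize_andF]; tauto

/-- realization with no free named variables -/
def Rz {n} (φ : BF n) (v : Fin n → W) : Prop := φ.Realize (default : Empty → W) v

theorem Rz_all {n} (φ : BF (n+1)) (v : Fin n → W) :
    Rz φ.all v ↔ ∀ x, Rz φ (Fin.snoc v x : Fin (n+1) → W) := Iff.rfl
theorem Rz_ex {n} (φ : BF (n+1)) (v : Fin n → W) :
    Rz φ.ex v ↔ ∃ x, Rz φ (Fin.snoc v x : Fin (n+1) → W) := BoundedFormula.realize_ex
theorem Rz_imp {n} (φ ψ : BF n) (v : Fin n → W) :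
    Rz (φ.imp ψ) v ↔ (Rz φ v → Rz ψ v) := Iff.rfl
theorem Rz_not {n} (φ : BF n) (v : Fin n → W) : Rz φ.not v ↔ ¬ Rz φ v := Iff.rfl
theorem Rz_and {n} (φ ψ : BF n) (v : Fin n → W) : Rz (andF φ ψ) v ↔ (Rz φ v ∧ Rz ψ v) :=
  realize_andF _ _ _ _
theorem Rz_or {n} (φ ψ : BF n) (v : Fin n → W) : Rz (orF φ ψ) v ↔ (Rz φ v ∨ Rz ψ v) :=
  realize_orF _ _ _ _
theorem Rz_iff {n} (φ ψ : BF n) (v : Fin n → W) : Rz (iffF φ ψ) v ↔ (Rz φ v ↔ Rz ψ v) :=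
  realize_iffF _ _ _ _
theorem Rz_mem {n} (i j : Fin n) (v : Fin n → W) : Rz (memf i j) v ↔ v i ∊ v j :=
  realize_memf _ _ _ _
theorem Rz_eq {n} (i j : Fin n) (v : Fin n → W) : Rz (eqf i j) v ↔ v i = v j :=
  realize_eqf _ _ _ _
theorem Rz_re {m k} (f : Fin m → Fin k) (φ : BF m) (v : Fin k → W) :
    Rz (reindex f φ) v ↔ Rz φ (fun i => v (f i)) := realize_reindex _ _ _ _

/-! ### definable predicates -/

/-- `P` is definable over `W` with parameters. -/
class Dfn (P : (ℕ → W) → Prop) : Prop where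
  out : ∃ (k : ℕ) (φ : BF k) (r : Fin k → ℕ ⊕ W), ∀ v, P v ↔ Rz φ (fun i => Sum.elim v id (r i))

/-- `f` has a definable graph. -/
class DF (f : (ℕ → W) → W) : Prop where
  out : Dfn (fun v : ℕ → W => v 0 = f (fun i => v (i + 1)))

theorem Dfn.congr {P Q : (ℕ → W) → Prop} (h : Dfn P) (e : ∀ v, Q v ↔ P v) : Dfn Q := by
  obtain ⟨k, φ, r, hr⟩ := h.out
  exact ⟨k, φ, r, fun v => (e v).trans (hr v)⟩

instance Dfn.ren (P : (ℕ → W) → Prop) (r : ℕ → ℕ) [h : Dfn P] :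
    Dfn (fun v : ℕ → W => P (fun i => v (r i))) := by
  obtain ⟨k, φ, s, hs⟩ := h.out
  refine ⟨k, φ, fun i => Sum.map r id (s i), fun v => (hs _).trans ?_⟩
  apply iff_of_eq; congr 1; funext i; rcases hi : s i <;> simp [hi]

/-- instantiating the variable 0 with a constant -/
theorem Dfn.inst (P : (ℕ → W) → Prop) (r : ℕ → ℕ ⊕ W) (h : Dfn P) :
    Dfn (fun v : ℕ → W => P (fun i => Sum.elim v id (r i))) := by
  obtain ⟨k, φ, s, hs⟩ := h.out
  refine ⟨k, φ, fun i => Sum.elim r Sum.inr (s i), fun v => (hs _).trans ?_⟩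
  apply iff_of_eq; congr 1; funext i; rcases hi : s i <;> simp [hi]

theorem Dfn.mem0 (i j : ℕ) : Dfn (fun v : ℕ → W => v i ∊ v j) :=
  ⟨2, memf 0 1, ![Sum.inl i, Sum.inl j], fun v => by rw [Rz_mem]; simp⟩
theorem Dfn.eq0 (i j : ℕ) : Dfn (fun v : ℕ → W => v i = v j) :=
  ⟨2, eqf 0 1, ![Sum.inl i, Sum.inl j], fun v => by rw [Rz_eq]; simp⟩
theorem Dfn.fls : Dfn (fun _ : ℕ → W => False) :=
  ⟨0, ⊥, Fin.elim0, fun _ => Iff.rfl⟩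

instance Dfn.imp (P Q : (ℕ → W) → Prop) [hP : Dfn P] [hQ : Dfn Q] : Dfn (fun v => P v → Q v) := by
  obtain ⟨k, φ, r, hr⟩ := hP.out
  obtain ⟨l, ψ, s, hs⟩ := hQ.out
  refine ⟨k + l, (reindex (Fin.castAdd l) φ).imp (reindex (Fin.natAdd k) ψ), Fin.append r s,
    fun v => ?_⟩
  rw [Rz_imp, Rz_re, Rz_re, hr, hs]; simp

instance Dfn.not (P : (ℕ → W) → Prop) [hP : Dfn P] : Dfn (fun v => ¬ P v) :=
  haveI := Dfn.fls (W := W)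
  Dfn.imp P (fun _ => False)
instance Dfn.and (P Q : (ℕ → W) → Prop) [hP : Dfn P] [hQ : Dfn Q] : Dfn (fun v => P v ∧ Q v) :=
  Dfn.congr (inferInstance : Dfn (fun v => ¬ (P v → ¬ Q v))) fun v => by tauto
instance Dfn.or (P Q : (ℕ → W) → Prop) [hP : Dfn P] [hQ : Dfn Q] : Dfn (fun v => P v ∨ Q v) :=
  Dfn.congr (inferInstance : Dfn (fun v => ¬ P v → Q v)) fun v => by tauto
instance Dfn.iff (P Q : (ℕ → W) → Prop) [hP : Dfn P] [hQ : Dfn Q] : Dfn (fun v => P v ↔ Q v) :=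
  Dfn.congr (inferInstance : Dfn (fun v => (P v → Q v) ∧ (Q v → P v))) fun v => by tauto
instance Dfn.const (c : Prop) : Dfn (fun _ : ℕ → W => c) := by
  by_cases h : c
  · exact Dfn.congr (haveI := Dfn.fls (W := W); inferInstance : Dfn (fun _ : ℕ → W => ¬ False))
      fun v => by simp [h]
  · exact Dfn.congr Dfn.fls fun v => by simp [h]

instance Dfn.all (P : W → (ℕ → W) → Prop) [h : Dfn (fun v => P (v 0) (fun i => v (i + 1)))] :
    Dfn (fun v => ∀ x, P x v) := by
  classical
  obtain ⟨k, φ, r, hr⟩ := h.out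
  refine ⟨k, (reindex (fun i => if r i = Sum.inl 0 then Fin.last k else Fin.castSucc i) φ).all,
    fun i => Sum.map (fun n => n - 1) id (r i), fun v => ?_⟩
  rw [Rz_all]
  refine forall_congr' fun x => ?_
  rw [Rz_re]
  have := hr (fun i => Nat.casesOn i x v)
  refine this.trans (iff_of_eq ?_)
  congr 1; funext i
  rcases hi : r i with (_ | n) | c <;> simp [hi]

instance Dfn.ex (P : W → (ℕ → W) → Prop) [h : Dfn (fun v => P (v 0) (fun i => v (i + 1)))] :
    Dfn (fun v => ∃ x, P x v) :=
  Dfn.congr (inferInstance : Dfn (fun v => ¬ ∀ x, ¬ P x v)) fun v => by simp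

instance DF.var (i : ℕ) : DF (fun v : ℕ → W => v i) := ⟨Dfn.eq0 0 (i + 1)⟩
instance DF.const (c : W) : DF (fun _ : ℕ → W => c) :=
  ⟨Dfn.inst _ (fun i => if i = 0 then .inl 0 else .inr c) (Dfn.eq0 0 1)⟩
instance DF.ren (f : (ℕ → W) → W) (r : ℕ → ℕ) [h : DF f] :
    DF (fun v : ℕ → W => f (fun i => v (r i))) := by
  have := h.out
  exact ⟨@Dfn.ren _ _ _ (fun i => Nat.casesOn i 0 (fun i => r i + 1)) this⟩

/-- substitution in the first variable -/
theorem Dfn.sub (P : W → (ℕ → W) → Prop) (f : (ℕ → W) → W) [hf : DF f]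
    [h : Dfn (fun v => P (v 0) (fun i => v (i + 1)))] : Dfn (fun v => P (f v) v) := by
  have := hf.out
  refine Dfn.congr (P := fun v => ∃ x, x = f v ∧ P x v) ?_ fun v => by simp
  infer_instance

theorem Dfn.comp1 {P : W → Prop} (h : Dfn (fun v => P (v 0))) (f : (ℕ → W) → W) [DF f] :
    Dfn (fun v => P (f v)) :=
  haveI := h; Dfn.sub (fun x _ => P x) f

theorem Dfn.comp2 {P : W → W → Prop} (h : Dfn (fun v => P (v 0) (v 1)))
    (f g : (ℕ → W) → W) [DF f] [DF g] : Dfn (fun v => P (f v) (g v)) := by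
  refine @Dfn.sub _ _ (fun x v => P x (g v)) f _ (@Dfn.sub _ _ (fun y v => P (v 0) y)
    (fun v => g (fun i => v (i+1))) _ ?_)
  exact @Dfn.ren _ _ _ (fun i => Nat.casesOn i 1 (fun _ => 0)) h

theorem Dfn.comp3 {P : W → W → W → Prop} (h : Dfn (fun v => P (v 0) (v 1) (v 2)))
    (f g k : (ℕ → W) → W) [DF f] [DF g] [DF k] : Dfn (fun v => P (f v) (g v) (k v)) := by
  refine @Dfn.sub _ _ (fun x v => P x (g v) (k v)) f _ (@Dfn.sub _ _ (fun y v => P (v 0) y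
    (k (fun i => v (i+1)))) (fun v => g (fun i => v (i+1))) _ (@Dfn.sub _ _
      (fun y v => P (v 1) (v 0) y) (fun v => k (fun i => v (i+1+1))) _ ?_))
  exact @Dfn.ren _ _ _ (fun i => Nat.casesOn i 2 (fun i => Nat.casesOn i 1 (fun _ => 0))) h

instance Dfn.mem (f g : (ℕ → W) → W) [DF f] [DF g] : Dfn (fun v => f v ∊ g v) :=
  Dfn.comp2 (P := fun x y => x ∊ y) (Dfn.mem0 0 1) f g
instance Dfn.eq (f g : (ℕ → W) → W) [DF f] [DF g] : Dfn (fun v => f v = g v) :=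
  Dfn.comp2 (P := fun x y => x = y) (Dfn.eq0 0 1) f g

theorem DF.comp1 {F : W → W} (h : DF (fun v => F (v 0))) (f : (ℕ → W) → W) [DF f] :
    DF (fun v => F (f v)) :=
  ⟨Dfn.comp2 (P := fun x y => x = F y) h.out (fun v => v 0) (fun v => f fun i => v (i+1))⟩
theorem DF.comp2 {F : W → W → W} (h : DF (fun v => F (v 0) (v 1))) (f g : (ℕ → W) → W)
    [DF f] [DF g] : DF (fun v => F (f v) (g v)) :=
  ⟨Dfn.comp3 (P := fun x y z => x = F y z) h.out (fun v => v 0) (fun v => f fun i => v (i+1))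
    (fun v => g fun i => v (i+1))⟩

/-- subset -/
def Sb (x y : W) : Prop := ∀ z, z ∊ x → z ∊ y
instance Dfn.sb (f g : (ℕ → W) → W) [DF f] [DF g] : Dfn (fun v => Sb (f v) (g v)) := by
  unfold Sb; infer_instance


/-- A definable predicate of one variable comes from a formula with parameters. -/
theorem Dfn.fm1 {P : W → Prop} (h : Dfn (fun v => P (v 0))) :
    ∃ (k : ℕ) (φ : BF (k+1)) (c : Fin k → W), ∀ x, P x ↔ Rz φ (Fin.snoc c x : Fin (k+1) → W) := by
  classical
  by_cases hW : Nonempty W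
  swap
  · exact ⟨0, ⊥, Fin.elim0, fun x => (hW ⟨x⟩).elim⟩
  obtain ⟨d⟩ := hW
  obtain ⟨k, φ, r, hr⟩ := h.out
  refine ⟨k, reindex (fun i => if r i = Sum.inl 0 then Fin.last k else Fin.castSucc i) φ,
    fun i => Sum.elim (fun _ => d) id (r i), fun x => ?_⟩
  rw [Rz_re]
  refine (hr (fun i => Nat.casesOn i x (fun _ => d))).trans (iff_of_eq ?_)
  congr 1; funext i
  rcases hi : r i with (_ | n) | c <;> simp [hi]

theorem Dfn.fm2 {P : W → W → Prop} (h : Dfn (fun v => P (v 0) (v 1))) :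
    ∃ (k : ℕ) (φ : BF (k+2)) (c : Fin k → W), ∀ x y, P x y ↔
      Rz φ (Fin.snoc (Fin.snoc c x : Fin (k+1) → W) y : Fin (k+2) → W) := by
  classical
  by_cases hW : Nonempty W
  swap
  · exact ⟨0, ⊥, Fin.elim0, fun x => (hW ⟨x⟩).elim⟩
  obtain ⟨d⟩ := hW
  obtain ⟨k, φ, r, hr⟩ := h.out
  refine ⟨k, reindex (fun i => if r i = Sum.inl 0 then Fin.castSucc (Fin.last k) else
    if r i = Sum.inl 1 then Fin.last (k+1) else Fin.castSucc (Fin.castSucc i)) φ,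
    fun i => Sum.elim (fun _ => d) id (r i), fun x y => ?_⟩
  rw [Rz_re]
  refine (hr (fun i => Nat.casesOn i x (fun i => Nat.casesOn i y fun _ => d))).trans (iff_of_eq ?_)
  congr 1; funext i
  rcases hi : r i with (_ | _ | n) | c <;> simp [hi]

end Basics
end CtmForcing

namespace CtmForcing
open FirstOrder FirstOrder.Language

/-- semantic form of ZF for a well-founded extensional structure -/
class ZFW (W : Type*) [SetLang.Structure W] : Prop where
  ext : ∀ x y : W, (∀ z, z ∊ x ↔ z ∊ y) → x = y
  wf : WellFounded (Mm : W → W → Prop)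
  pair : ∀ a b : W, ∃ c, ∀ x, x ∊ c ↔ x = a ∨ x = b
  union : ∀ a : W, ∃ c, ∀ x, x ∊ c ↔ ∃ y, y ∊ a ∧ x ∊ y
  pow : ∀ a : W, ∃ c, ∀ x, x ∊ c ↔ Sb x a
  inf : ∃ I : W, (∃ e, e ∊ I ∧ ∀ x, ¬ x ∊ e) ∧
    ∀ k, k ∊ I → ∃ k', k' ∊ I ∧ ∀ x, x ∊ k' ↔ x ∊ k ∨ x = k
  sepA : ∀ (n : ℕ) (φ : BF (n+1)) (c : Fin n → W) (a : W), ∃ b, ∀ x,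
    x ∊ b ↔ x ∊ a ∧ Rz φ (Fin.snoc c x : Fin (n+1) → W)
  replA : ∀ (n : ℕ) (φ : BF (n+2)) (c : Fin n → W) (a : W),
    (∀ x y y', x ∊ a → Rz φ (Fin.snoc (Fin.snoc c x : Fin (n+1) → W) y : Fin (n+2) → W) →
      Rz φ (Fin.snoc (Fin.snoc c x : Fin (n+1) → W) y' : Fin (n+2) → W) → y = y') →
    ∃ b, ∀ y, y ∊ b ↔ ∃ x, x ∊ a ∧ Rz φ (Fin.snoc (Fin.snoc c x : Fin (n+1) → W) y : Fin (n+2) → W)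

noncomputable section SetOps
variable {W : Type*} [SetLang.Structure W] [Z : ZFW W]

theorem sep (P : W → Prop) [h : Dfn (fun v => P (v 0))] (a : W) :
    ∃ b, ∀ x, x ∊ b ↔ x ∊ a ∧ P x := by
  obtain ⟨k, φ, c, hc⟩ := h.fm1
  simpa [hc] using Z.sepA k φ c a

theorem repl (R : W → W → Prop) [h : Dfn (fun v => R (v 0) (v 1))] (a : W)
    (hf : ∀ x y y', x ∊ a → R x y → R x y' → y = y') :
    ∃ b, ∀ y, y ∊ b ↔ ∃ x, x ∊ a ∧ R x y := by
  obtain ⟨k, φ, c, hc⟩ := h.fm2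
  simp only [hc] at hf ⊢
  exact Z.replA k φ c a hf

theorem Sb.antisymm {x y : W} (h : Sb x y) (h' : Sb y x) : x = y :=
  Z.ext _ _ fun z => ⟨h z, h' z⟩

theorem DF.of_mem (P : W → (ℕ → W) → Prop) [Dfn (fun v => P (v 0) (fun i => v (i + 1)))]
    (f : (ℕ → W) → W) (h : ∀ v x, x ∊ f v ↔ P x v) : DF f := by
  refine ⟨Dfn.congr (P := fun v => ∀ x, x ∊ v 0 ↔ P x (fun i => v (i + 1))) ?_ fun v => ?_⟩
  · have : Dfn (fun v : ℕ → W => P (v 0) (fun i => v (i + 1 + 1))) :=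
      @Dfn.ren W _ (fun v => P (v 0) (fun i => v (i + 1)))
        (fun i => Nat.casesOn i 0 fun i => i + 1 + 1) _
    infer_instance
  · constructor
    · intro e x; rw [e, h]
    · intro e; apply Z.ext; intro x; rw [e, h]

/-- unordered pair -/
def up (a b : W) : W := (Z.pair a b).choose
theorem mem_up (a b x : W) : x ∊ up a b ↔ x = a ∨ x = b := (Z.pair a b).choose_spec x
/-- union -/
def un (a : W) : W := (Z.union a).choose
theorem mem_un (a x : W) : x ∊ un a ↔ ∃ y, y ∊ a ∧ x ∊ y := (Z.union a).choose_spec x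
/-- power set -/
def pw (a : W) : W := (Z.pow a).choose
theorem mem_pw (a x : W) : x ∊ pw a ↔ Sb x a := (Z.pow a).choose_spec x
/-- ordered pair -/
def pr (a b : W) : W := up (up a a) (up a b)

instance (f g : (ℕ → W) → W) [DF f] [DF g] : DF (fun v => up (f v) (g v)) :=
  DF.of_mem (fun x v => x = f v ∨ x = g v) _ fun _ _ => mem_up _ _ _
instance (f : (ℕ → W) → W) [DF f] : DF (fun v => un (f v)) :=
  DF.of_mem (fun x v => ∃ y, y ∊ f v ∧ x ∊ y) _ fun _ _ => mem_un _ _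
instance (f : (ℕ → W) → W) [DF f] : DF (fun v => pw (f v)) :=
  DF.of_mem (fun x v => Sb x (f v)) _ fun _ _ => mem_pw _ _
instance (f g : (ℕ → W) → W) [DF f] [DF g] : DF (fun v => pr (f v) (g v)) := by
  unfold pr; infer_instance

theorem up_inj {a b c d : W} (h : up a b = up c d) : (a = c ∧ b = d) ∨ (a = d ∧ b = c) := by
  have h1 := mem_up c d a; have h2 := mem_up c d b
  have h3 := mem_up a b c; have h4 := mem_up a b d
  rw [← h, mem_up] at h1 h2; rw [h, mem_up] at h3 h4
  grind

theorem pr_inj {a b c d : W} : pr a b = pr c d ↔ a = c ∧ b = d := by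
  constructor
  · intro h
    rcases up_inj h with ⟨h1, h2⟩ | ⟨h1, h2⟩
    · rcases up_inj h1 with ⟨h1, -⟩ | ⟨h1, -⟩ <;> rcases up_inj h2 with ⟨-, h2⟩ | ⟨h2, h3⟩ <;> grind
    · rcases up_inj h1 with ⟨h1, h3⟩ | ⟨h1, h3⟩ <;> rcases up_inj h2 with ⟨h4, h2⟩ | ⟨h4, h2⟩ <;>
        grind
  · rintro ⟨rfl, rfl⟩; rfl

theorem pr_left {a b z : W} (h : pr a b ∊ z) : a ∊ un (un z) := by
  rw [mem_un]; refine ⟨up a a, ?_, by simp [mem_up]⟩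
  rw [mem_un]; exact ⟨_, h, by simp [pr, mem_up]⟩
theorem pr_right {a b z : W} (h : pr a b ∊ z) : b ∊ un (un z) := by
  rw [mem_un]; refine ⟨up a b, ?_, by simp [mem_up]⟩
  rw [mem_un]; exact ⟨_, h, by simp [pr, mem_up]⟩

theorem exists_prod (a b : W) : ∃ c, ∀ z, z ∊ c ↔ ∃ x y, x ∊ a ∧ y ∊ b ∧ z = pr x y := by
  obtain ⟨c, hc⟩ := sep (fun z => ∃ x y, x ∊ a ∧ y ∊ b ∧ z = pr x y) (pw (pw (un (up a b))))
  refine ⟨c, fun z => (hc z).trans ⟨fun h => h.2, fun h => ⟨?_, h⟩⟩⟩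
  obtain ⟨x, y, hx, hy, rfl⟩ := h
  rw [mem_pw]; intro u hu
  rw [mem_pw]; intro w hw
  rw [pr, mem_up] at hu
  rw [mem_un]
  rcases hu with rfl | rfl <;> rw [mem_up] at hw <;> rcases hw with rfl | rfl
  exacts [⟨a, by simp [mem_up], hx⟩, ⟨a, by simp [mem_up], hx⟩, ⟨a, by simp [mem_up], hx⟩,
    ⟨b, by simp [mem_up], hy⟩]
/-- product -/
def prd (a b : W) : W := (exists_prod a b).choose
theorem mem_prd (a b z : W) : z ∊ prd a b ↔ ∃ x y, x ∊ a ∧ y ∊ b ∧ z = pr x y :=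
  (exists_prod a b).choose_spec z

theorem exists_dm (a : W) : ∃ c, ∀ x, x ∊ c ↔ ∃ y, pr x y ∊ a := by
  obtain ⟨c, hc⟩ := sep (fun x => ∃ y : W, pr x y ∊ a) (un (un a))
  exact ⟨c, fun z => (hc z).trans ⟨fun h => h.2, fun h => ⟨pr_left h.choose_spec, h⟩⟩⟩
/-- domain -/
def dm (a : W) : W := (exists_dm a).choose
theorem mem_dm (a x : W) : x ∊ dm a ↔ ∃ y, pr x y ∊ a := (exists_dm a).choose_spec x
instance (f : (ℕ → W) → W) [DF f] : DF (fun v => dm (f v)) :=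
  DF.of_mem (fun x v => ∃ y, pr x y ∊ f v) _ fun _ _ => mem_dm _ _

/-! ### definable recursion -/
section Rec
variable (S : W → W) (F : W → W → W)

/-- `f` is a partial solution of the recursion on the closed set `t` -/
def Good (t f : W) : Prop := (∀ y, y ∊ t → Sb (S y) t) ∧ ∀ y, y ∊ t → ∃ h,
  (∀ z, z ∊ h ↔ z ∊ f ∧ ∃ u, u ∊ S y ∧ ∃ w, z = pr u w) ∧ ∀ w, pr y w ∊ f ↔ w = F y h
/-- the recursively defined relation -/
def KK (u w : W) : Prop := ∃ t f, Good S F t f ∧ u ∊ t ∧ pr u w ∊ f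
/-- `t` is the closure of `x` -/
def isC (x t : W) : Prop := (∀ y, y ∊ t → Sb (S y) t) ∧ x ∊ t ∧
  ∀ t', (∀ y, y ∊ t' → Sb (S y) t') → x ∊ t' → Sb t t'

variable {S F}
theorem Good.uniq (wf : WellFounded fun y x => y ∊ S x) {t f t' f' : W} (g : Good S F t f)
    (g' : Good S F t' f') (u : W) : u ∊ t → u ∊ t' → ∀ w, pr u w ∊ f ↔ pr u w ∊ f' := by
  induction u using wf.induction with
  | _ u ih =>
    intro hu hu' w
    obtain ⟨h, h1, h2⟩ := g.2 u hu
    obtain ⟨h', h1', h2'⟩ := g'.2 u hu'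
    have : h = h' := by
      apply Z.ext; intro z; rw [h1, h1']
      constructor
      · rintro ⟨a, v, hv, w, rfl⟩
        exact ⟨(ih v hv (g.1 u hu v hv) (g'.1 u hu' v hv) w).1 a, v, hv, w, rfl⟩
      · rintro ⟨a, v, hv, w, rfl⟩
        exact ⟨(ih v hv (g.1 u hu v hv) (g'.1 u hu' v hv) w).2 a, v, hv, w, rfl⟩
    rw [h2, h2', this]

theorem KK.uniq (wf : WellFounded fun y x => y ∊ S x) {u w w' : W} (k : KK S F u w)
    (k' : KK S F u w') : w = w' := by
  obtain ⟨t, f, g, h, e⟩ := k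
  obtain ⟨t', f', g', h', e'⟩ := k'
  have e2 := (g.uniq wf g' u h h' w).1 e
  obtain ⟨h, -, q⟩ := g'.2 u h'
  rw [(q _).1 e2, (q _).1 e']

theorem exists_C [hS : DF (fun v : ℕ → W => S (v 0))] (wf : WellFounded fun y x => y ∊ S x)
    (x : W) : ∃ t, isC S x t := by
  have iS : ∀ f [DF f], DF (fun v : ℕ → W => S (f v)) := fun f _ => hS.comp1 f
  induction x using wf.induction with
  | _ x ih =>
    have : Dfn (fun v : ℕ → W => isC S (v 0) (v 1)) := by unfold isC; infer_instance
    obtain ⟨b, hb⟩ := repl (fun y t => isC S y t) (S x) (fun y t t' _ h h' =>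
      Sb.antisymm (h.2.2 _ h'.1 h'.2.1) (h'.2.2 _ h.1 h.2.1))
    have key : ∀ z, z ∊ un (up (un b) (up x x)) ↔ z = x ∨ ∃ t y, y ∊ S x ∧ isC S y t ∧ z ∊ t := by
      intro z; simp only [mem_un, mem_up]
      constructor
      · rintro ⟨y, rfl | rfl, h⟩
        · rw [mem_un] at h; obtain ⟨t, ht, hz⟩ := h
          obtain ⟨y, h1, h2⟩ := (hb t).1 ht
          exact Or.inr ⟨t, y, h1, h2, hz⟩
        · rw [mem_up] at h; tauto
      · rintro (rfl | ⟨t, y, h1, h2, h3⟩)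
        · exact ⟨_, Or.inr rfl, by simp [mem_up]⟩
        · exact ⟨_, Or.inl rfl, (mem_un _ _).2 ⟨t, (hb t).2 ⟨y, h1, h2⟩, h3⟩⟩
    refine ⟨un (up (un b) (up x x)), ?_, (key x).2 (Or.inl rfl), ?_⟩
    · intro z hz w hw
      rw [key] at hz ⊢
      rcases hz with rfl | ⟨t, y, h1, h2, h3⟩
      · obtain ⟨t, ht⟩ := ih w hw
        exact Or.inr ⟨t, w, hw, ht, ht.2.1⟩
      · exact Or.inr ⟨t, y, h1, h2, h2.1 z h3 w hw⟩
    · intro t' ht' hx z hz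
      rcases (key z).1 hz with rfl | ⟨t, y, h1, h2, h3⟩
      · exact hx
      · exact h2.2.2 t' ht' (ht' x hx y h1) z h3

theorem exists_K [hS : DF (fun v : ℕ → W => S (v 0))] [hF : DF (fun v : ℕ → W => F (v 0) (v 1))]
    (iK : ∀ f g [DF f] [DF g], Dfn (fun v : ℕ → W => KK S F (f v) (g v)))
    (wf : WellFounded fun y x => y ∊ S x) (x : W) : ∃ w, KK S F x w := by
  induction x using wf.induction with
  | _ x ih =>
    by_contra! hn
    obtain ⟨t, ht⟩ := exists_C wf x
    have hK : ∀ u, u ∊ t → u = x ∨ ∃ w, KK S F u w := by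
      obtain ⟨t1, ht1⟩ := sep (fun u => u = x ∨ ∃ w, KK S F u w) t
      have := ht.2.2 t1 ?_ ((ht1 x).2 ⟨ht.2.1, Or.inl rfl⟩)
      · exact fun u hu => ((ht1 u).1 (this u hu)).2
      · intro y hy z hz
        rw [ht1] at hy ⊢
        refine ⟨ht.1 y hy.1 z hz, Or.inr ?_⟩
        rcases hy.2 with rfl | ⟨w, t', f', g, h, -⟩
        · exact ih z hz
        · obtain ⟨k, -, h2⟩ := g.2 z (g.1 y h z hz)
          exact ⟨_, t', f', g, g.1 y h z hz, (h2 _).2 rfl⟩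
    obtain ⟨hx, hhx⟩ := repl (fun u z => ∃ w, KK S F u w ∧ z = pr u w) (S x) (by
      rintro u _ _ - ⟨w, h, rfl⟩ ⟨w', h', rfl⟩; rw [h.uniq wf h'])
    obtain ⟨f, hf⟩ := repl (fun u z => ∃ w : W, z = pr u w ∧ ((u = x ∧ w = F x hx) ∨ KK S F u w)) t (by
      rintro u _ _ - ⟨w, rfl, h⟩ ⟨w', rfl, h'⟩
      rcases h with ⟨rfl, rfl⟩ | h <;> rcases h' with ⟨h1, rfl⟩ | h'
      · rfl
      · exact (hn _ h').elim
      · exact (hn _ (h1 ▸ h)).elim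
      · rw [h.uniq wf h'])
    have hf' : ∀ u w, u ∊ t → (pr u w ∊ f ↔ ((u = x ∧ w = F x hx) ∨ KK S F u w)) := by
      intro u w hu; rw [hf]
      constructor
      · rintro ⟨u', -, w', e, h⟩
        rw [pr_inj] at e; obtain ⟨rfl, rfl⟩ := e; exact h
      · intro h; exact ⟨u, hu, w, rfl, h⟩
    refine hn (F x hx) ⟨t, f, ⟨ht.1, fun y hy => ?_⟩, ht.2.1, (hf' _ _ ht.2.1).2 (Or.inl ⟨rfl, rfl⟩)⟩
    rcases hK y hy with rfl | ⟨w, hw⟩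
    · refine ⟨hx, fun z => ?_, fun w => ?_⟩
      · rw [hhx]
        constructor
        · rintro ⟨u, hu, w, k, rfl⟩
          exact ⟨(hf' _ _ (ht.1 _ hy u hu)).2 (Or.inr k), u, hu, w, rfl⟩
        · rintro ⟨h, u, hu, w, rfl⟩
          rcases (hf' _ _ (ht.1 _ hy u hu)).1 h with ⟨rfl, -⟩ | h
          · obtain ⟨w, hw⟩ := ih _ hu; exact (hn _ hw).elim
          · exact ⟨u, hu, w, h, rfl⟩
      · rw [hf' _ _ hy]
        constructor
        · rintro (h | h)
          exacts [h.2, (hn _ h).elim]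
        · intro h; exact Or.inl ⟨rfl, h⟩
    · have hyx : y ≠ x := by rintro rfl; exact hn _ hw
      have hw0 := hw
      obtain ⟨t', f', g, h, e⟩ := hw
      obtain ⟨k, h1, h2⟩ := g.2 y h
      have tr : ∀ u w, u ∊ t → u ∊ t' → (pr u w ∊ f ↔ pr u w ∊ f') := by
        intro u w hu hu'
        rw [hf' u w hu]
        constructor
        · rintro (⟨rfl, -⟩ | ⟨t2, f2, g2, hu2, e2⟩)
          · obtain ⟨k, -, h2⟩ := g.2 _ hu'
            exact (hn _ ⟨t', f', g, hu', (h2 _).2 rfl⟩).elim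
          · exact (g2.uniq wf g u hu2 hu' w).1 e2
        · intro h; exact Or.inr ⟨t', f', g, hu', h⟩
      refine ⟨k, fun z => ?_, fun w => (tr y w hy h).trans (h2 w)⟩
      rw [h1]
      constructor
      · rintro ⟨a, u, hu, w, rfl⟩
        exact ⟨(tr u w (ht.1 _ hy u hu) (g.1 _ h u hu)).2 a, u, hu, w, rfl⟩
      · rintro ⟨a, u, hu, w, rfl⟩
        exact ⟨(tr u w (ht.1 _ hy u hu) (g.1 _ h u hu)).1 a, u, hu, w, rfl⟩

theorem recn (S : W → W) (F : W → W → W) [hS : DF (fun v : ℕ → W => S (v 0))]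
    [hF : DF (fun v : ℕ → W => F (v 0) (v 1))] (wf : WellFounded fun y x => y ∊ S x) :
    ∃ H : W → W, DF (fun v : ℕ → W => H (v 0)) ∧
      ∀ x, ∃ h, (∀ z, z ∊ h ↔ ∃ y, y ∊ S x ∧ z = pr y (H y)) ∧ H x = F x h := by
  have iS : ∀ f [DF f], DF (fun v : ℕ → W => S (f v)) := fun f _ => hS.comp1 f
  have iF : ∀ f g [DF f] [DF g], DF (fun v : ℕ → W => F (f v) (g v)) := fun f g _ _ => hF.comp2 f g
  have iG : Dfn (fun v : ℕ → W => Good S F (v 0) (v 1)) := by unfold Good; infer_instance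
  have iG' : ∀ f g [DF f] [DF g], Dfn (fun v : ℕ → W => Good S F (f v) (g v)) :=
    fun f g _ _ => iG.comp2 f g
  have iK : ∀ f g [DF f] [DF g], Dfn (fun v : ℕ → W => KK S F (f v) (g v)) := by
    intro f g _ _; unfold KK; infer_instance
  choose H hH using exists_K iK wf
  refine ⟨H, ⟨Dfn.congr (iK (fun v => v 1) (fun v => v 0)) fun v => ?_⟩, fun x => ?_⟩
  · exact ⟨fun h => by rw [h]; exact hH _, fun h => h.uniq wf (hH _)⟩
  · obtain ⟨t, f, g, hx, hf⟩ := hH x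
    obtain ⟨h, h1, h2⟩ := g.2 x hx
    refine ⟨h, fun z => (h1 z).trans ?_, (h2 _).1 hf⟩
    constructor
    · rintro ⟨a, u, hu, w, rfl⟩
      refine ⟨u, hu, ?_⟩
      rw [KK.uniq wf ⟨t, f, g, g.1 _ hx u hu, a⟩ (hH u)]
    · rintro ⟨u, hu, rfl⟩
      refine ⟨?_, u, hu, _, rfl⟩
      obtain ⟨t', f', g', hx', hf'⟩ := hH u
      exact (g'.uniq wf g u hx' (g.1 _ hx u hu) _).1 hf'
end Rec
end SetOps
end CtmForcing

namespace CtmForcing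
open FirstOrder FirstOrder.Language

noncomputable section Hier
variable {W : Type*} [SetLang.Structure W] [Z : ZFW W]

theorem exists_hier : ∃ H : W → W, DF (fun v : ℕ → W => H (v 0)) ∧
    ∀ x z, z ∊ H x ↔ ∃ y, y ∊ x ∧ Sb z (H y) := by
  have : ∀ h : W, ∃ c, ∀ z, z ∊ c ↔ ∃ u w, pr u w ∊ h ∧ Sb z w := by
    intro h
    obtain ⟨c, hc⟩ := sep (fun z => ∃ u w : W, pr u w ∊ h ∧ Sb z w) (pw (un (un (un h))))
    refine ⟨c, fun z => (hc z).trans ⟨fun h => h.2, fun h => ⟨?_, h⟩⟩⟩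
    obtain ⟨u, w, h1, h2⟩ := h
    rw [mem_pw]; intro y hy
    exact (mem_un _ _).2 ⟨w, pr_right h1, h2 y hy⟩
  choose F hF using this
  have : DF (fun v : ℕ → W => F (v 1)) := DF.of_mem (fun z v => ∃ u w, pr u w ∊ v 1 ∧ Sb z w) _
    fun v z => hF _ _
  obtain ⟨H, h1, h2⟩ := recn (fun x : W => x) (fun _ h => F h) Z.wf
  refine ⟨H, h1, fun x z => ?_⟩
  obtain ⟨h, h3, h4⟩ := h2 x
  rw [h4, hF]
  constructor
  · rintro ⟨u, w, a, b⟩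
    obtain ⟨y, hy, e⟩ := (h3 _).1 a
    rw [pr_inj] at e; obtain ⟨rfl, rfl⟩ := e
    exact ⟨u, hy, b⟩
  · rintro ⟨y, hy, a⟩
    exact ⟨y, H y, (h3 _).2 ⟨y, hy, rfl⟩, a⟩

/-- rank -/
def rkW (x : W) : Ordinal := haveI : IsWellFounded W Mm := ⟨Z.wf⟩; IsWellFounded.rank (Mm (W := W)) x
theorem lt_rkW {x : W} {o : Ordinal} : o < rkW x ↔ ∃ y, y ∊ x ∧ o ≤ rkW y := by
  have : IsWellFounded W Mm := ⟨Z.wf⟩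
  unfold rkW
  rw [IsWellFounded.rank_eq, Ordinal.lt_iSup_iff]
  simp
theorem rkW_le {x : W} {o : Ordinal} : rkW x ≤ o ↔ ∀ y, y ∊ x → rkW y < o := by
  rw [← not_lt, lt_rkW]; simp

theorem mem_hier {H : W → W} (h : ∀ x z, z ∊ H x ↔ ∃ y, y ∊ x ∧ Sb z (H y)) (x z : W) :
    z ∊ H x ↔ rkW z < rkW x := by
  induction x using Z.wf.induction generalizing z with
  | _ x ih =>
    rw [h, lt_rkW]
    refine exists_congr fun y => and_congr_right fun hy => ?_
    rw [rkW_le]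
    exact forall_congr' fun w => imp_congr_right fun _ => ih y hy w

theorem coll (R : W → W → Prop) [h : Dfn (fun v => R (v 0) (v 1))] (a : W) :
    ∃ b, ∀ x, x ∊ a → (∃ y, R x y) → ∃ y, y ∊ b ∧ R x y := by
  obtain ⟨H, h1, h2⟩ := exists_hier (W := W)
  have h3 := mem_hier h2
  have iH : ∀ f [DF f], DF (fun v : ℕ → W => H (f v)) := fun f _ => h1.comp1 f
  have iR : ∀ f g [DF f] [DF g], Dfn (fun v : ℕ → W => R (f v) (g v)) := fun f g _ _ => h.comp2 f g
  obtain ⟨b, hb⟩ := repl (fun x z => (∃ w, z = H w) ∧ (∃ y, y ∊ z ∧ R x y) ∧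
    ∀ w, (∃ y, y ∊ H w ∧ R x y) → Sb z (H w)) a (by
      rintro x _ _ - ⟨⟨w, rfl⟩, h, h'⟩ ⟨⟨w', rfl⟩, k, k'⟩
      exact Sb.antisymm (h' _ k) (k' _ h))
  refine ⟨un b, fun x hx ⟨y, hy⟩ => ?_⟩
  obtain ⟨w, hw, hw'⟩ := exists_minimalFor_of_wellFoundedLT (fun w => ∃ y, y ∊ H w ∧ R x y) rkW
    ⟨up y y, y, (h3 _ _).2 (lt_rkW.2 ⟨y, (mem_up _ _ _).2 (Or.inl rfl), le_rfl⟩), hy⟩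
  obtain ⟨y', hy', r⟩ := hw
  refine ⟨y', (mem_un _ _).2 ⟨H w, (hb _).2 ⟨x, hx, ⟨w, rfl⟩, ⟨y', hy', r⟩, fun w' e z hz => ?_⟩, hy'⟩,
    r⟩
  rw [h3] at hz ⊢
  refine hz.trans_le ?_
  by_contra! hlt
  exact absurd (hw' e hlt.le) (not_le.2 hlt)

theorem exists_image (F : W → W) [h : DF (fun v : ℕ → W => F (v 0))] (a : W) :
    ∃ b, ∀ z, z ∊ b ↔ ∃ x, x ∊ a ∧ z = F x := by
  have iH : ∀ f [DF f], DF (fun v : ℕ → W => F (f v)) := fun f _ => h.comp1 f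
  exact repl (fun x z => z = F x) a (by rintro x _ _ - rfl rfl; rfl)

theorem exists_chk (one : W) : ∃ H : W → W, DF (fun v : ℕ → W => H (v 0)) ∧
    ∀ x z, z ∊ H x ↔ ∃ y, y ∊ x ∧ z = pr (H y) one := by
  have : ∀ h : W, ∃ c, ∀ z, z ∊ c ↔ ∃ u w, pr u w ∊ h ∧ z = pr w one := by
    intro h
    obtain ⟨c, hc⟩ := repl (fun q z => ∃ u w : W, q = pr u w ∧ z = pr w one) h (by
      rintro x _ _ - ⟨u, w, rfl, rfl⟩ ⟨u', w', e, rfl⟩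
      rw [(pr_inj.1 e).2])
    refine ⟨c, fun z => (hc z).trans ?_⟩
    constructor
    · rintro ⟨q, hq, u, w, rfl, rfl⟩; exact ⟨u, w, hq, rfl⟩
    · rintro ⟨u, w, hq, rfl⟩; exact ⟨_, hq, u, w, rfl, rfl⟩
  choose F hF using this
  have : DF (fun v : ℕ → W => F (v 1)) :=
    DF.of_mem (fun z v => ∃ u w, pr u w ∊ v 1 ∧ z = pr w one) _ fun v z => hF _ _
  obtain ⟨H, h1, h2⟩ := recn (fun x : W => x) (fun _ h => F h) Z.wf
  refine ⟨H, h1, fun x z => ?_⟩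
  obtain ⟨h, h3, h4⟩ := h2 x
  rw [h4, hF]
  constructor
  · rintro ⟨u, w, a, b⟩
    obtain ⟨y, hy, e⟩ := (h3 _).1 a
    rw [pr_inj] at e; obtain ⟨rfl, rfl⟩ := e
    exact ⟨u, hy, b⟩
  · rintro ⟨y, hy, a⟩
    exact ⟨y, H y, (h3 _).2 ⟨y, hy, rfl⟩, a⟩

theorem wf_dm : WellFounded (fun y x : W => y ∊ dm x) := by
  refine Subrelation.wf ?_ Z.wf.transGen
  intro y x h
  obtain ⟨s, hs⟩ := (mem_dm _ _).1 h
  refine .tail (.tail (.single (b := up y y) ?_) (c := pr y s) ?_) hs <;> simp [mem_up, pr]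

/-- forcing posets -/
structure FP (W : Type*) [SetLang.Structure W] where
  P : W
  le : W → W → Prop
  one : W
  dle : Dfn (fun v => le (v 0) (v 1))
  memP : ∀ {p q}, le p q → p ∊ P ∧ q ∊ P
  refl : ∀ {p}, p ∊ P → le p p
  trans : ∀ {p q r}, le p q → le q r → le p r
  top : ∀ {p}, p ∊ P → le p one
  oneP : one ∊ P

variable (A : FP W)
instance (f g : (ℕ → W) → W) [DF f] [DF g] : Dfn (fun v => A.le (f v) (g v)) := A.dle.comp2 f g

theorem exists_S : ∃ S : W → W, DF (fun v : ℕ → W => S (v 0)) ∧ (∀ x z, z ∊ S x ↔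
    ∃ σ τ ρ ρ', x = pr σ τ ∧ z = pr ρ ρ' ∧ ρ ∊ dm σ ∧ ρ' ∊ dm τ) := by
  have : ∀ x : W, ∃ c, ∀ z, z ∊ c ↔ ∃ σ τ ρ ρ', x = pr σ τ ∧ z = pr ρ ρ' ∧ ρ ∊ dm σ ∧ ρ' ∊ dm τ := by
    intro x
    by_cases hx : ∃ σ τ, x = pr σ τ
    · obtain ⟨σ, τ, rfl⟩ := hx
      refine ⟨prd (dm σ) (dm τ), fun z => (mem_prd _ _ _).trans ?_⟩
      constructor
      · rintro ⟨ρ, ρ', h1, h2, rfl⟩; exact ⟨σ, τ, ρ, ρ', rfl, rfl, h1, h2⟩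
      · rintro ⟨σ', τ', ρ, ρ', e, rfl, h1, h2⟩
        obtain ⟨rfl, rfl⟩ := pr_inj.1 e
        exact ⟨ρ, ρ', h1, h2, rfl⟩
    · obtain ⟨c, hc⟩ := sep (fun _ => False) x
      refine ⟨c, fun z => ?_⟩
      rw [hc]; simp only [and_false, false_iff]
      rintro ⟨σ, τ, ρ, ρ', rfl, -⟩; exact hx ⟨σ, τ, rfl⟩
  choose S hS using this
  exact ⟨S, DF.of_mem (fun z v => ∃ σ τ ρ ρ', v 0 = pr σ τ ∧ z = pr ρ ρ' ∧ ρ ∊ dm σ ∧ ρ' ∊ dm τ) _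
    fun v z => hS _ _, hS⟩

theorem exists_Q : ∃ Q : W → W → W → Prop, Dfn (fun v => Q (v 0) (v 1) (v 2)) ∧
    ∀ p σ τ, Q p σ τ ↔ p ∊ A.P ∧
      (∀ ρ s, pr ρ s ∊ σ → ∀ q, A.le q p → A.le q s → ∃ r, A.le r q ∧
        ∃ ρ' s', pr ρ' s' ∊ τ ∧ A.le r s' ∧ Q r ρ ρ') ∧
      (∀ ρ' s', pr ρ' s' ∊ τ → ∀ q, A.le q p → A.le q s' → ∃ r, A.le r q ∧
        ∃ ρ s, pr ρ s ∊ σ ∧ A.le r s ∧ Q r ρ ρ') := by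
  obtain ⟨S, iS, hS⟩ := exists_S (W := W)
  have wf : WellFounded fun y x => y ∊ S x := by
    have h1 : ∀ σ τ, Acc (fun y x => y ∊ S x) (pr σ τ) := by
      intro σ
      induction σ using (wf_dm (W := W)).induction with
      | _ σ ih =>
        intro τ; constructor; intro y hy
        obtain ⟨σ', τ', ρ, ρ', e, rfl, h1, h2⟩ := (hS _ _).1 hy
        obtain ⟨rfl, rfl⟩ := pr_inj.1 e
        exact ih ρ h1 ρ'
    constructor; intro x; constructor; intro y hy
    obtain ⟨σ', τ', ρ, ρ', e, rfl, -⟩ := (hS _ _).1 hy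
    exact h1 _ _
  let Φ : W → W → W → Prop := fun p x h => p ∊ A.P ∧ ∃ σ τ, x = pr σ τ ∧
      (∀ ρ s, pr ρ s ∊ σ → ∀ q, A.le q p → A.le q s → ∃ r, A.le r q ∧
        ∃ ρ' s', pr ρ' s' ∊ τ ∧ A.le r s' ∧ ∃ e, pr (pr ρ ρ') e ∊ h ∧ r ∊ e) ∧
      (∀ ρ' s', pr ρ' s' ∊ τ → ∀ q, A.le q p → A.le q s' → ∃ r, A.le r q ∧
        ∃ ρ s, pr ρ s ∊ σ ∧ A.le r s ∧ ∃ e, pr (pr ρ ρ') e ∊ h ∧ r ∊ e)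
  have iΦ : ∀ f g k [DF f] [DF g] [DF k], Dfn (fun v : ℕ → W => Φ (f v) (g v) (k v)) := by
    intro f g k _ _ _; simp only [Φ]; infer_instance
  have : ∀ x h : W, ∃ c, ∀ p, p ∊ c ↔ Φ p x h := by
    intro x h
    obtain ⟨c, hc⟩ := sep (fun p => Φ p x h) A.P
    exact ⟨c, fun p => (hc p).trans ⟨fun h => h.2, fun h => ⟨h.1, h⟩⟩⟩
  choose F hF using this
  have : DF (fun v : ℕ → W => F (v 0) (v 1)) :=
    DF.of_mem (fun p v => Φ p (v 0) (v 1)) _ fun v z => hF _ _ _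
  obtain ⟨H, h1, h2⟩ := recn S F wf
  have iH : ∀ f [DF f], DF (fun v : ℕ → W => H (f v)) := fun f _ => h1.comp1 f
  refine ⟨fun p σ τ => p ∊ H (pr σ τ), inferInstance, fun p σ τ => ?_⟩
  obtain ⟨h, h3, h4⟩ := h2 (pr σ τ)
  have key : ∀ ρ s ρ' s', pr ρ s ∊ σ → pr ρ' s' ∊ τ → ∀ r,
      ((∃ e, pr (pr ρ ρ') e ∊ h ∧ r ∊ e) ↔ r ∊ H (pr ρ ρ')) := by
    intro ρ s ρ' s' a b r
    constructor
    · rintro ⟨e, h5, h6⟩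
      obtain ⟨y, -, h7⟩ := (h3 _).1 h5
      obtain ⟨rfl, rfl⟩ := pr_inj.1 h7
      exact h6
    · intro h5
      exact ⟨_, (h3 _).2 ⟨_, (hS _ _).2 ⟨σ, τ, ρ, ρ', rfl, rfl, (mem_dm _ _).2 ⟨s, a⟩,
        (mem_dm _ _).2 ⟨s', b⟩⟩, rfl⟩, h5⟩
  show p ∊ H (pr σ τ) ↔ _
  rw [h4, hF]
  simp only [Φ]
  refine and_congr_right fun hp => ?_
  constructor
  · rintro ⟨σ', τ', e, h5, h6⟩
    obtain ⟨rfl, rfl⟩ := pr_inj.1 e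
    refine ⟨fun ρ s a q b c => ?_, fun ρ s a q b c => ?_⟩
    · obtain ⟨r, h7, ρ', s', h8, h9, h10⟩ := h5 ρ s a q b c
      exact ⟨r, h7, ρ', s', h8, h9, (key _ _ _ _ a h8 _).1 h10⟩
    · obtain ⟨r, h7, ρ', s', h8, h9, h10⟩ := h6 ρ s a q b c
      exact ⟨r, h7, ρ', s', h8, h9, (key _ _ _ _ h8 a _).1 h10⟩
  · rintro ⟨h5, h6⟩
    refine ⟨σ, τ, rfl, fun ρ s a q b c => ?_, fun ρ s a q b c => ?_⟩
    · obtain ⟨r, h7, ρ', s', h8, h9, h10⟩ := h5 ρ s a q b c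
      exact ⟨r, h7, ρ', s', h8, h9, (key _ _ _ _ a h8 _).2 h10⟩
    · obtain ⟨r, h7, ρ', s', h8, h9, h10⟩ := h6 ρ s a q b c
      exact ⟨r, h7, ρ', s', h8, h9, (key _ _ _ _ h8 a _).2 h10⟩

/-- forcing equality -/
def Q (p σ τ : W) : Prop := (exists_Q A).choose p σ τ
theorem Q_iff (p σ τ : W) : Q A p σ τ ↔ p ∊ A.P ∧
      (∀ ρ s, pr ρ s ∊ σ → ∀ q, A.le q p → A.le q s → ∃ r, A.le r q ∧
        ∃ ρ' s', pr ρ' s' ∊ τ ∧ A.le r s' ∧ Q A r ρ ρ') ∧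
      (∀ ρ' s', pr ρ' s' ∊ τ → ∀ q, A.le q p → A.le q s' → ∃ r, A.le r q ∧
        ∃ ρ s, pr ρ s ∊ σ ∧ A.le r s ∧ Q A r ρ ρ') := (exists_Q A).choose_spec.2 p σ τ
instance (f g k : (ℕ → W) → W) [DF f] [DF g] [DF k] : Dfn (fun v => Q A (f v) (g v) (k v)) :=
  (exists_Q A).choose_spec.1.comp3 f g k

/-- forcing membership -/
def Qm (p σ τ : W) : Prop := ∀ q, A.le q p → ∃ r, A.le r q ∧ ∃ ρ s, pr ρ s ∊ τ ∧ A.le r s ∧ Q A r σ ρ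
instance (f g k : (ℕ → W) → W) [DF f] [DF g] [DF k] : Dfn (fun v => Qm A (f v) (g v) (k v)) := by
  unfold Qm; infer_instance

/-- the variable of a term -/
def tv {n : ℕ} : SetLang.Term (Empty ⊕ Fin n) → Fin n
  | .var (.inr i) => i
  | .var (.inl e) => e.elim
  | .func f _ => Empty.elim f

/-- forcing an atomic relation -/
def Fr {n l : ℕ} (R : memRel l) (t : Fin l → Fin n) (p : W) (v : Fin n → W) : Prop :=
  match R with
  | .mem => Qm A p (v (t 0)) (v (t 1))

/-- the forcing relation -/
def Fc : ∀ {n : ℕ}, BF n → W → (Fin n → W) → Prop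
  | _, .falsum, _, _ => False
  | _, .equal t s, p, v => Q A p (v (tv t)) (v (tv s))
  | _, .rel R ts, p, v => Fr A R (fun i => tv (ts i)) p v
  | _, .imp φ ψ, p, v => ∀ q, A.le q p → Fc φ q v → Fc ψ q v
  | _, .all φ, p, v => ∀ x, Fc φ p (Fin.snoc v x)

theorem Q_mono {p q σ τ : W} (h : Q A p σ τ) (hq : A.le q p) : Q A q σ τ := by
  rw [Q_iff] at h ⊢
  exact ⟨(A.memP hq).1, fun ρ s a r b => h.2.1 ρ s a r (A.trans b hq),
    fun ρ s a r b => h.2.2 ρ s a r (A.trans b hq)⟩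

theorem Q_reg {p σ τ : W} (hp : p ∊ A.P) (h : ∀ q, A.le q p → ∃ r, A.le r q ∧ Q A r σ τ) :
    Q A p σ τ := by
  rw [Q_iff]
  refine ⟨hp, fun ρ s a q b c => ?_, fun ρ s a q b c => ?_⟩ <;>
  obtain ⟨r, h1, h2⟩ := h q b <;> rw [Q_iff] at h2
  · obtain ⟨r', h3, h4⟩ := h2.2.1 ρ s a r (A.refl (A.memP h1).1) (A.trans h1 c)
    exact ⟨r', A.trans h3 h1, h4⟩
  · obtain ⟨r', h3, h4⟩ := h2.2.2 ρ s a r (A.refl (A.memP h1).1) (A.trans h1 c)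
    exact ⟨r', A.trans h3 h1, h4⟩

theorem Fc_mono {n : ℕ} (φ : BF n) : ∀ {p q : W} {v : Fin n → W}, Fc A φ p v → A.le q p →
    Fc A φ q v := by
  induction φ with
  | falsum => intro p q v h _; exact h
  | equal t s => intro p q v h hq; exact Q_mono A h hq
  | rel R ts =>
    intro p q v h hq
    cases R
    exact fun r hr => h r (A.trans hr hq)
  | imp φ ψ _ _ => intro p q v h hq r hr; exact h r (A.trans hr hq)
  | all φ ih => intro p q v h hq x; exact ih (h x) hq

theorem Fc_reg {n : ℕ} (φ : BF n) : ∀ {p : W} {v : Fin n → W}, p ∊ A.P →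
    (∀ q, A.le q p → ∃ r, A.le r q ∧ Fc A φ r v) → Fc A φ p v := by
  induction φ with
  | falsum =>
    intro p v hp h
    obtain ⟨r, -, hr⟩ := h p (A.refl hp); exact hr
  | equal t s => intro p v hp h; exact Q_reg A hp h
  | rel R ts =>
    intro p v hp h
    cases R
    intro q hq
    obtain ⟨r, h1, h2⟩ := h q hq
    obtain ⟨r', h3, h4⟩ := h2 r (A.refl (A.memP h1).1)
    exact ⟨r', A.trans h3 h1, h4⟩
  | imp φ ψ _ ih =>
    intro p v hp h q hq hφ
    refine ih (A.memP hq).1 fun q' hq' => ?_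
    obtain ⟨r, h1, h2⟩ := h q' (A.trans hq' hq)
    exact ⟨r, h1, h2 r (A.refl (A.memP h1).1) (Fc_mono A φ hφ (A.trans h1 hq'))⟩
  | all φ ih =>
    intro p v hp h x
    refine ih hp fun q hq => ?_
    obtain ⟨r, h1, h2⟩ := h q hq
    exact ⟨r, h1, h2 x⟩

theorem Fc_dfn {n : ℕ} (φ : BF n) : ∀ (f : (ℕ → W) → W) (g : Fin n → (ℕ → W) → W) [DF f]
    (_ : ∀ i, DF (g i)), Dfn (fun u => Fc A φ (f u) (fun i => g i u)) := by
  induction φ with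
  | falsum => intro f g _ _; exact Dfn.fls
  | equal t s => intro f g _ hg; simp only [Fc]; infer_instance
  | rel R ts => intro f g _ hg; cases R; simp only [Fc, Fr]; infer_instance
  | imp φ ψ h1 h2 =>
    intro f g _ hg; simp only [Fc]
    have a := h1 (fun u => u 0) (fun j u => g j (fun i => u (i + 1))) (fun j => haveI := hg j; DF.ren (g j) (fun i => i + 1))
    have b := h2 (fun u => u 0) (fun j u => g j (fun i => u (i + 1))) (fun j => haveI := hg j; DF.ren (g j) (fun i => i + 1))
    infer_instance
  | all φ ih =>
    intro f g _ hg; simp only [Fc]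
    have a := ih (fun u => f (fun i => u (i + 1))) (Fin.snoc (α := fun _ => (ℕ → W) → W)
      (fun j u => g j (fun i => u (i + 1))) (fun u => u 0)) (fun j => by
        refine Fin.lastCases ?_ (fun j => ?_) j
        · rw [Fin.snoc_last]; infer_instance
        · rw [Fin.snoc_castSucc]; haveI := hg j; exact DF.ren (g j) (fun i => i + 1))
    have : Dfn (fun u : ℕ → W => Fc A φ (f (fun i => u (i + 1)))
        (Fin.snoc (α := fun _ => W) (fun j => g j (fun i => u (i + 1))) (u 0))) := by
      refine a.congr fun u => iff_of_eq ?_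
      congr 1; funext j
      refine Fin.lastCases ?_ (fun j => ?_) j <;> simp
    infer_instance
end Hier
end CtmForcing

namespace CtmForcing
open FirstOrder FirstOrder.Language

noncomputable section Truth
variable {W : Type*} [SetLang.Structure W] [Z : ZFW W]

/-- generic filters -/
structure IsGen (A : FP W) (G : W → Prop) : Prop where
  sub : ∀ {p}, G p → p ∊ A.P
  one : G A.one
  up : ∀ {p q}, G p → A.le p q → G q
  dir : ∀ {p q}, G p → G q → ∃ r, G r ∧ A.le r p ∧ A.le r q
  gen : ∀ D : W, (∀ p, p ∊ A.P → ∃ q, q ∊ D ∧ A.le q p) → ∃ q, G q ∧ q ∊ D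

variable {A : FP W} {G : W → Prop}

theorem IsGen.dfn (hG : IsGen A G) (D : W → Prop) [h : Dfn (fun v => D (v 0))]
    (hD : ∀ p, p ∊ A.P → ∃ q, D q ∧ A.le q p) : ∃ q, G q ∧ D q := by
  obtain ⟨d, hd⟩ := sep D A.P
  obtain ⟨q, h1, h2⟩ := hG.gen d (fun p hp => by
    obtain ⟨q, h1, h2⟩ := hD p hp
    exact ⟨q, (hd q).2 ⟨(A.memP h2).1, h1⟩, h2⟩)
  exact ⟨q, h1, ((hd q).1 h2).2⟩

theorem IsGen.below (hG : IsGen A G) (D : W → Prop) [h : Dfn (fun v => D (v 0))] {p : W} (hp : G p)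
    (hD : ∀ q, A.le q p → ∃ r, A.le r q ∧ D r) : ∃ q, G q ∧ D q := by
  obtain ⟨q, h1, h2⟩ := hG.dfn (fun r => D r ∨ ∀ r', A.le r' r → ¬ A.le r' p) (fun q hq => by
    by_cases hc : ∃ r, A.le r q ∧ A.le r p
    · obtain ⟨r, h1, h2⟩ := hc
      obtain ⟨r', h3, h4⟩ := hD r h2
      exact ⟨r', Or.inl h4, A.trans h3 h1⟩
    · push Not at hc
      exact ⟨q, Or.inr hc, A.refl hq⟩)
  rcases h2 with h2 | h2
  · exact ⟨q, h1, h2⟩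
  · obtain ⟨r, -, h3, h4⟩ := hG.dir h1 hp
    exact (h2 r h3 h4).elim

instance Fc_dfn0 (A : FP W) {n : ℕ} (φ : BF n) (c : Fin n → W) (f : (ℕ → W) → W) [DF f] :
    Dfn (fun u => Fc A φ (f u) c) := Fc_dfn A φ f (fun i _ => c i) (fun _ => inferInstance)

instance Fc_dfn1 (A : FP W) {n : ℕ} (φ : BF (n+1)) (c : Fin n → W) (f g : (ℕ → W) → W) [DF f] [DF g] :
    Dfn (fun u => Fc A φ (f u) (Fin.snoc c (g u) : Fin (n+1) → W)) := by
  refine (Fc_dfn A φ f (Fin.snoc (α := fun _ => (ℕ → W) → W) (fun i _ => c i) g) (fun j => ?_)).congr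
    fun u => iff_of_eq ?_
  · refine Fin.lastCases ?_ (fun j => ?_) j
    · rw [Fin.snoc_last]; infer_instance
    · rw [Fin.snoc_castSucc]; infer_instance
  · congr 1; funext j
    refine Fin.lastCases ?_ (fun j => ?_) j <;> simp

instance Fc_dfn2 (A : FP W) {n : ℕ} (φ : BF (n+2)) (c : Fin n → W) (f g k : (ℕ → W) → W)
    [DF f] [DF g] [DF k] :
    Dfn (fun u => Fc A φ (f u) (Fin.snoc (Fin.snoc c (g u) : Fin (n+1) → W) (k u) : Fin (n+2) → W)) := by
  refine (Fc_dfn A φ f (Fin.snoc (α := fun _ => (ℕ → W) → W)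
    (Fin.snoc (α := fun _ => (ℕ → W) → W) (fun i _ => c i) g) k) (fun j => ?_)).congr
    fun u => iff_of_eq ?_
  · refine Fin.lastCases ?_ (fun j => ?_) j
    · rw [Fin.snoc_last]; infer_instance
    · rw [Fin.snoc_castSucc]
      refine Fin.lastCases ?_ (fun j => ?_) j
      · rw [Fin.snoc_last]; infer_instance
      · rw [Fin.snoc_castSucc]; infer_instance
  · congr 1; funext j
    refine Fin.lastCases ?_ (fun j => ?_) j
    · simp
    · refine Fin.lastCases ?_ (fun j => ?_) j <;> simp

variable {U : Type*} [SetLang.Structure U]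

/-- the generic extension: interpretation of names -/
structure IsNv (A : FP W) (G : W → Prop) (nv : W → U) : Prop where
  gen : IsGen A G
  ext : ∀ x y : U, (∀ z, z ∊ x ↔ z ∊ y) → x = y
  wf : WellFounded (Mm : U → U → Prop)
  surj : Function.Surjective nv
  mem : ∀ x z, z ∊ nv x ↔ ∃ ρ p, G p ∧ pr ρ p ∊ x ∧ z = nv ρ

variable {nv : W → U}

theorem truth_eq (hN : IsNv A G nv) (σ τ : W) : (∃ p, G p ∧ Q A p σ τ) ↔ nv σ = nv τ := by
  have hG := hN.gen
  induction σ using (wf_dm (W := W)).induction generalizing τ with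
  | _ σ ih =>
  constructor
  · rintro ⟨p, hp, hQ⟩
    rw [Q_iff] at hQ
    apply hN.ext
    intro z
    rw [hN.mem, hN.mem]
    constructor
    · rintro ⟨ρ, s, hs, hρ, rfl⟩
      obtain ⟨q, hq, h1, h2⟩ := hG.dir hp hs
      obtain ⟨r, hr, ρ', s', h3, h4, h5⟩ := hG.below (fun r => ∃ ρ' s' : W, pr ρ' s' ∊ τ ∧ A.le r s' ∧
        Q A r ρ ρ') hq (fun q' hq' => hQ.2.1 ρ s hρ q' (A.trans hq' h1) (A.trans hq' h2))
      exact ⟨ρ', s', hG.up hr h4, h3, (ih ρ ((mem_dm _ _).2 ⟨_, hρ⟩) ρ').1 ⟨r, hr, h5⟩⟩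
    · rintro ⟨ρ, s, hs, hρ, rfl⟩
      obtain ⟨q, hq, h1, h2⟩ := hG.dir hp hs
      obtain ⟨r, hr, ρ', s', h3, h4, h5⟩ := hG.below (fun r => ∃ ρ' s' : W, pr ρ' s' ∊ σ ∧ A.le r s' ∧
        Q A r ρ' ρ) hq (fun q' hq' => hQ.2.2 ρ s hρ q' (A.trans hq' h1) (A.trans hq' h2))
      exact ⟨ρ', s', hG.up hr h4, h3, ((ih ρ' ((mem_dm _ _).2 ⟨_, h3⟩) ρ).1 ⟨r, hr, h5⟩).symm⟩
  · intro e
    obtain ⟨r, hr, h⟩ := hG.dfn (fun r => Q A r σ τ ∨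
      (∃ ρ s : W, pr ρ s ∊ σ ∧ A.le r s ∧ ∀ r', A.le r' r → ¬ ∃ ρ' s' : W, pr ρ' s' ∊ τ ∧ A.le r' s' ∧
        Q A r' ρ ρ') ∨
      (∃ ρ s : W, pr ρ s ∊ τ ∧ A.le r s ∧ ∀ r', A.le r' r → ¬ ∃ ρ' s' : W, pr ρ' s' ∊ σ ∧ A.le r' s' ∧
        Q A r' ρ' ρ)) (fun p hp => by
      by_contra! hc
      refine hc p (Or.inl ?_) (A.refl hp)
      rw [Q_iff]
      refine ⟨hp, fun ρ s a q b c => ?_, fun ρ s a q b c => ?_⟩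
      · by_contra! hn
        exact hc q (Or.inr (Or.inl ⟨ρ, s, a, c, hn⟩)) b
      · by_contra! hn
        exact hc q (Or.inr (Or.inr ⟨ρ, s, a, c, hn⟩)) b)
    rcases h with h | ⟨ρ, s, h1, h2, h3⟩ | ⟨ρ, s, h1, h2, h3⟩
    · exact ⟨r, hr, h⟩
    · exfalso
      have : nv ρ ∊ nv τ := by rw [← e, hN.mem]; exact ⟨ρ, s, hG.up hr h2, h1, rfl⟩
      obtain ⟨ρ', s', h4, h5, h6⟩ := (hN.mem _ _).1 this
      obtain ⟨t, h7, h8⟩ := (ih ρ ((mem_dm _ _).2 ⟨_, h1⟩) ρ').2 h6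
      obtain ⟨q, h9, h10, h11⟩ := hG.dir hr h4
      obtain ⟨q', h12, h13, h14⟩ := hG.dir h9 h7
      exact h3 q' (A.trans h13 h10) ⟨ρ', s', h5, A.trans h13 h11, Q_mono A h8 h14⟩
    · exfalso
      have : nv ρ ∊ nv σ := by rw [e, hN.mem]; exact ⟨ρ, s, hG.up hr h2, h1, rfl⟩
      obtain ⟨ρ', s', h4, h5, h6⟩ := (hN.mem _ _).1 this
      obtain ⟨t, h7, h8⟩ := (ih ρ' ((mem_dm _ _).2 ⟨_, h5⟩) ρ).2 h6.symm
      obtain ⟨q, h9, h10, h11⟩ := hG.dir hr h4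
      obtain ⟨q', h12, h13, h14⟩ := hG.dir h9 h7
      exact h3 q' (A.trans h13 h10) ⟨ρ', s', h5, A.trans h13 h11, Q_mono A h8 h14⟩

theorem truth_mem (hN : IsNv A G nv) (σ τ : W) : (∃ p, G p ∧ Qm A p σ τ) ↔ nv σ ∊ nv τ := by
  have hG := hN.gen
  constructor
  · rintro ⟨p, hp, h⟩
    obtain ⟨r, hr, ρ, s, h1, h2, h3⟩ := hG.below (fun r => ∃ ρ s : W, pr ρ s ∊ τ ∧ A.le r s ∧
      Q A r σ ρ) hp h
    exact (hN.mem _ _).2 ⟨ρ, s, hG.up hr h2, h1, (truth_eq hN _ _).1 ⟨r, hr, h3⟩⟩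
  · intro h
    obtain ⟨ρ, s, hs, h1, h2⟩ := (hN.mem _ _).1 h
    obtain ⟨t, ht, h3⟩ := (truth_eq hN _ _).2 h2
    obtain ⟨p, hp, h4, h5⟩ := hG.dir hs ht
    exact ⟨p, hp, fun q hq => ⟨q, A.refl (A.memP hq).1, ρ, s, h1, A.trans hq h4,
      Q_mono A h3 (A.trans hq h5)⟩⟩

theorem realize_tv {n : ℕ} (t : SetLang.Term (Empty ⊕ Fin n)) (v : Fin n → U) :
    t.realize (Sum.elim (default : Empty → U) v) = v (tv t) := by
  match t with
  | .var (.inr i) => rfl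
  | .var (.inl e) => exact e.elim
  | .func f _ => exact Empty.elim f

theorem truth {n : ℕ} (hN : IsNv A G nv) (φ : BF n) (v : Fin n → W) :
    (∃ p, G p ∧ Fc A φ p v) ↔ Rz φ (fun i => nv (v i)) := by
  have hG := hN.gen
  induction φ with
  | falsum => exact ⟨fun ⟨p, _, h⟩ => h.elim, fun h => False.elim h⟩
  | equal t s =>
    refine (truth_eq hN _ _).trans ?_
    unfold Rz BoundedFormula.Realize
    rw [realize_tv, realize_tv]
  | rel R ts =>
    cases R
    refine (truth_mem hN _ _).trans ?_
    unfold Rz BoundedFormula.Realize Mm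
    simp only [realize_tv]
    apply iff_of_eq; congr 1; funext i
    refine Fin.cases ?_ (fun i => ?_) i
    · rfl
    · rw [Subsingleton.elim i 0]; rfl
  | imp φ ψ h1 h2 =>
    refine Iff.trans ?_ (Rz_imp φ ψ _).symm
    have h1' : (∃ p, G p ∧ Fc A φ p v) ↔ Rz φ (fun i => nv (v i)) := h1 v
    have h2' : (∃ p, G p ∧ Fc A ψ p v) ↔ Rz ψ (fun i => nv (v i)) := h2 v
    rw [← h1', ← h2']
    constructor
    · rintro ⟨p, hp, h⟩ ⟨q, hq, h'⟩
      obtain ⟨r, hr, a, b⟩ := hG.dir hp hq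
      exact ⟨r, hr, h r a (Fc_mono A _ h' b)⟩
    · intro h
      obtain ⟨r, hr, h3⟩ := hG.dfn (fun r => Fc A (φ.imp ψ) r v ∨ (Fc A φ r v ∧ ∀ r', A.le r' r →
        ¬ Fc A ψ r' v)) (fun p hp => by
        by_cases hc : Fc A (φ.imp ψ) p v
        · exact ⟨p, Or.inl hc, A.refl hp⟩
        · simp only [Fc] at hc
          push Not at hc
          obtain ⟨q, hq, h3, h4⟩ := hc
          have := mt (Fc_reg A ψ (A.memP hq).1) h4
          push Not at this
          obtain ⟨q', h5, h6⟩ := this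
          exact ⟨q', Or.inr ⟨Fc_mono A _ h3 h5, h6⟩, A.trans h5 hq⟩)
      rcases h3 with h3 | ⟨h3, h4⟩
      · exact ⟨r, hr, h3⟩
      · obtain ⟨t, ht, h5⟩ := h ⟨r, hr, h3⟩
        obtain ⟨r', -, a, b⟩ := hG.dir hr ht
        exact (h4 r' a (Fc_mono A _ h5 b)).elim
  | all φ ih =>
    have key : ∀ x, (fun i => nv ((Fin.snoc v x : Fin _ → W) i)) = Fin.snoc (fun i => nv (v i)) (nv x) := by
      intro x; funext j
      refine Fin.lastCases ?_ (fun j => ?_) j <;> simp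
    rw [Rz_all]
    have : (∀ x, Rz φ (Fin.snoc (fun i => nv (v i)) x : Fin _ → U)) ↔
        ∀ x, ∃ p, G p ∧ Fc A φ p (Fin.snoc v x) := by
      simp only [ih, key]
      exact hN.surj.forall
    rw [this]
    constructor
    · rintro ⟨p, hp, h⟩ x
      exact ⟨p, hp, h x⟩
    · intro h
      obtain ⟨r, hr, h3⟩ := hG.dfn (fun r => Fc A φ.all r v ∨ (∃ x : W, ∀ r', A.le r' r →
        ¬ Fc A φ r' (Fin.snoc v x))) (fun p hp => by
        by_cases hc : Fc A φ.all p v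
        · exact ⟨p, Or.inl hc, A.refl hp⟩
        · simp only [Fc] at hc
          push Not at hc
          obtain ⟨x, h3⟩ := hc
          have := mt (Fc_reg A φ hp) h3
          push Not at this
          obtain ⟨q, h5, h6⟩ := this
          exact ⟨q, Or.inr ⟨x, h6⟩, h5⟩)
      rcases h3 with h3 | ⟨x, h4⟩
      · exact ⟨r, hr, h3⟩
      · obtain ⟨t, ht, h5⟩ := h x
        obtain ⟨r', -, a, b⟩ := hG.dir hr ht
        exact (h4 r' a (Fc_mono A _ h5 b)).elim

theorem star (hN : IsNv A G nv) (b : W) : ∃ b', ∀ z, z ∊ nv b' ↔ ∃ σ, σ ∊ b ∧ z = nv σ := by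
  obtain ⟨c, hc⟩ := exists_image (fun σ => pr σ A.one) b
  refine ⟨c, fun z => (hN.mem _ _).trans ?_⟩
  constructor
  · rintro ⟨ρ, p, h1, h2, rfl⟩
    obtain ⟨σ, h3, h4⟩ := (hc _).1 h2
    obtain ⟨rfl, rfl⟩ := pr_inj.1 h4
    exact ⟨_, h3, rfl⟩
  · rintro ⟨σ, h1, rfl⟩
    exact ⟨σ, A.one, hN.gen.one, (hc _).2 ⟨σ, h1, rfl⟩, rfl⟩

theorem nv_chk (hN : IsNv A G nv) {H : W → W} (hH : ∀ x z, z ∊ H x ↔ ∃ y, y ∊ x ∧ z = pr (H y) A.one) (x : W) (z : U) :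
    z ∊ nv (H x) ↔ ∃ y, y ∊ x ∧ z = nv (H y) := by
  rw [hN.mem]
  constructor
  · rintro ⟨ρ, p, h1, h2, rfl⟩
    obtain ⟨y, h3, h4⟩ := (hH _ _).1 h2
    obtain ⟨rfl, rfl⟩ := pr_inj.1 h4
    exact ⟨_, h3, rfl⟩
  · rintro ⟨y, h1, rfl⟩
    exact ⟨_, _, hN.gen.one, (hH _ _).2 ⟨y, h1, rfl⟩, rfl⟩

theorem ext_sepA (hN : IsNv A G nv) (n : ℕ) (φ : BF (n+1)) (c : Fin n → U) (a : U) : ∃ b, ∀ x,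
    x ∊ b ↔ x ∊ a ∧ Rz φ (Fin.snoc c x : Fin (n+1) → U) := by
  have hG := hN.gen
  obtain ⟨τ, rfl⟩ := hN.surj a
  choose c' hc' using fun i => hN.surj (c i)
  obtain ⟨s, hs⟩ := sep (fun u => ∃ ρ p : W, u = pr ρ p ∧ Qm A p ρ τ ∧ Fc A φ p (Fin.snoc c' ρ))
    (prd (dm τ) A.P)
  have key : ∀ x, Rz φ (Fin.snoc c (nv x) : Fin (n+1) → U) ↔ ∃ p, G p ∧ Fc A φ p (Fin.snoc c' x) := by
    intro x; rw [truth hN]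
    apply iff_of_eq; congr 1; funext j
    refine Fin.lastCases ?_ (fun j => ?_) j <;> simp [hc']
  refine ⟨nv s, fun x => ?_⟩
  constructor
  · intro h
    obtain ⟨ρ, p, h1, h2, rfl⟩ := (hN.mem _ _).1 h
    obtain ⟨h3, ρ', p', h4, h5, h6⟩ := (hs _).1 h2
    obtain ⟨rfl, rfl⟩ := pr_inj.1 h4
    exact ⟨(truth_mem hN _ _).1 ⟨_, h1, h5⟩, (key _).2 ⟨_, h1, h6⟩⟩
  · rintro ⟨h1, h2⟩
    obtain ⟨ρ, q, h3, h4, rfl⟩ := (hN.mem _ _).1 h1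
    obtain ⟨p1, a1, b1⟩ := (truth_mem hN _ _).2 h1
    obtain ⟨p2, a2, b2⟩ := (key _).1 h2
    obtain ⟨p, hp, h5, h6⟩ := hG.dir a1 a2
    refine (hN.mem _ _).2 ⟨ρ, p, hp, (hs _).2 ⟨(mem_prd _ _ _).2 ⟨ρ, p, (mem_dm _ _).2 ⟨_, h4⟩,
      hG.sub hp, rfl⟩, ρ, p, rfl, fun r hr => b1 r (A.trans hr h5), Fc_mono A _ b2 h6⟩, rfl⟩

theorem ext_sep (hN : IsNv A G nv) (P : U → Prop) (h : Dfn (fun v => P (v 0))) (a : U) :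
    ∃ b, ∀ x, x ∊ b ↔ x ∊ a ∧ P x := by
  obtain ⟨k, φ, c, hc⟩ := h.fm1
  simpa [hc] using ext_sepA hN k φ c a

theorem ext_zfw (hN : IsNv A G nv) : ZFW U where
  ext := hN.ext
  wf := hN.wf
  pair a b := by
    obtain ⟨σ, rfl⟩ := hN.surj a
    obtain ⟨τ, rfl⟩ := hN.surj b
    obtain ⟨c, hc⟩ := star hN (up σ τ)
    refine ⟨nv c, fun x => (hc x).trans ?_⟩
    simp [mem_up]
  union a := by
    obtain ⟨τ, rfl⟩ := hN.surj a
    obtain ⟨c, hc⟩ := star hN (dm (un (dm τ)))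
    obtain ⟨d, hd⟩ := ext_sep hN (fun x => ∃ y, y ∊ nv τ ∧ x ∊ y) inferInstance (nv c)
    refine ⟨d, fun x => (hd x).trans ⟨fun h => h.2, fun h => ⟨?_, h⟩⟩⟩
    obtain ⟨y, h1, h2⟩ := h
    obtain ⟨ρ, p, h3, h4, rfl⟩ := (hN.mem _ _).1 h1
    obtain ⟨ρ', p', h5, h6, rfl⟩ := (hN.mem _ _).1 h2
    exact (hc _).2 ⟨ρ', (mem_dm _ _).2 ⟨p', (mem_un _ _).2 ⟨ρ, (mem_dm _ _).2 ⟨_, h4⟩, h6⟩⟩, rfl⟩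
  pow a := by
    obtain ⟨τ, rfl⟩ := hN.surj a
    obtain ⟨c, hc⟩ := star hN (pw (prd (dm τ) A.P))
    obtain ⟨d, hd⟩ := ext_sep hN (fun x => Sb x (nv τ)) inferInstance (nv c)
    refine ⟨d, fun x => (hd x).trans ⟨fun h => h.2, fun h => ⟨?_, h⟩⟩⟩
    obtain ⟨σ, rfl⟩ := hN.surj x
    obtain ⟨s, hs⟩ := sep (fun u => ∃ ρ p : W, u = pr ρ p ∧ Qm A p ρ σ) (prd (dm τ) A.P)
    refine (hc _).2 ⟨s, (mem_pw _ _).2 fun z hz => ((hs z).1 hz).1, hN.ext _ _ fun z => ?_⟩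
    constructor
    · intro hz
      obtain ⟨ρ, p, h3, h4, e⟩ := (hN.mem _ _).1 (h z hz)
      rw [e] at hz ⊢
      obtain ⟨p', h5, h6⟩ := (truth_mem hN _ _).2 hz
      exact (hN.mem _ _).2 ⟨ρ, p', h5, (hs _).2 ⟨(mem_prd _ _ _).2 ⟨ρ, p', (mem_dm _ _).2 ⟨_, h4⟩,
        hN.gen.sub h5, rfl⟩, ρ, p', rfl, h6⟩, rfl⟩
    · intro hz
      obtain ⟨ρ, p, h3, h4, rfl⟩ := (hN.mem _ _).1 hz
      obtain ⟨-, ρ', p', h5, h6⟩ := (hs _).1 h4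
      obtain ⟨rfl, rfl⟩ := pr_inj.1 h5
      exact (truth_mem hN _ _).1 ⟨_, h3, h6⟩
  inf := by
    obtain ⟨H, -, hH⟩ := exists_chk A.one
    have hk := nv_chk hN hH
    obtain ⟨I, ⟨e, h1, h2⟩, h3⟩ := Z.inf
    refine ⟨nv (H I), ⟨nv (H e), (hk _ _).2 ⟨e, h1, rfl⟩, fun x hx => ?_⟩, fun k hk' => ?_⟩
    · obtain ⟨y, hy, -⟩ := (hk _ _).1 hx
      exact h2 _ hy
    · obtain ⟨k, hk1, rfl⟩ := (hk _ _).1 hk'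
      obtain ⟨k', h4, h5⟩ := h3 k hk1
      refine ⟨nv (H k'), (hk _ _).2 ⟨_, h4, rfl⟩, fun x => ?_⟩
      rw [hk, hk]
      constructor
      · rintro ⟨y, hy, rfl⟩
        rcases (h5 _).1 hy with hy | rfl
        · exact Or.inl ⟨_, hy, rfl⟩
        · exact Or.inr rfl
      · rintro (⟨y, hy, rfl⟩ | rfl)
        · exact ⟨_, (h5 _).2 (Or.inl hy), rfl⟩
        · exact ⟨_, (h5 _).2 (Or.inr rfl), rfl⟩
  sepA := ext_sepA hN
  replA n φ c a hf := by
    obtain ⟨τ, rfl⟩ := hN.surj a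
    choose c' hc' using fun i => hN.surj (c i)
    obtain ⟨b, hb⟩ := coll (fun u σ => ∃ ρ p : W, u = pr ρ p ∧ Fc A φ p
      (Fin.snoc (Fin.snoc c' ρ : Fin (n+1) → W) σ : Fin (n+2) → W)) (prd (dm τ) A.P)
    have key : ∀ x y, Rz φ (Fin.snoc (Fin.snoc c (nv x) : Fin (n+1) → U) (nv y) : Fin (n+2) → U) ↔
        ∃ p, G p ∧ Fc A φ p (Fin.snoc (Fin.snoc c' x : Fin (n+1) → W) y : Fin (n+2) → W) := by
      intro x y; rw [truth hN]
      apply iff_of_eq; congr 1; funext j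
      refine Fin.lastCases ?_ (fun j => ?_) j
      · simp
      · refine Fin.lastCases ?_ (fun j => ?_) j <;> simp [hc']
    obtain ⟨c1, hc1⟩ := star hN b
    have : Dfn (fun u : ℕ → U => Rz φ (Fin.snoc (Fin.snoc c (u 0) : Fin (n+1) → U) (u 1) : Fin (n+2) → U)) := by
      refine ⟨n+2, φ, Fin.snoc (α := fun _ => ℕ ⊕ U) (Fin.snoc (α := fun _ => ℕ ⊕ U)
        (fun i => .inr (c i)) (.inl 0)) (.inl 1), fun u => iff_of_eq ?_⟩
      congr 1; funext j
      refine Fin.lastCases ?_ (fun j => ?_) j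
      · simp
      · refine Fin.lastCases ?_ (fun j => ?_) j <;> simp
    have i2 : ∀ f g [DF f] [DF g], Dfn (fun u : ℕ → U => Rz φ (Fin.snoc (Fin.snoc c (f u) : Fin (n+1) → U)
      (g u) : Fin (n+2) → U)) := fun f g _ _ => Dfn.comp2 (P := fun x y => Rz φ
        (Fin.snoc (Fin.snoc c x : Fin (n+1) → U) y : Fin (n+2) → U)) this f g
    obtain ⟨d, hd⟩ := ext_sep hN (fun y => ∃ x : U, x ∊ nv τ ∧
      Rz φ (Fin.snoc (Fin.snoc c x : Fin (n+1) → U) y : Fin (n+2) → U)) inferInstance (nv c1)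
    refine ⟨d, fun y => (hd y).trans ⟨fun h => h.2, fun h => ⟨?_, h⟩⟩⟩
    obtain ⟨x, h1, h2⟩ := h
    have h1' := h1
    obtain ⟨ρ, q, h3, h4, rfl⟩ := (hN.mem _ _).1 h1
    obtain ⟨σ, rfl⟩ := hN.surj y
    obtain ⟨p, h5, h6⟩ := (key _ _).1 h2
    obtain ⟨σ', h7, ρ', p', h8, h9⟩ := hb (pr ρ p) ((mem_prd _ _ _).2 ⟨ρ, p, (mem_dm _ _).2 ⟨_, h4⟩,
      hN.gen.sub h5, rfl⟩) ⟨σ, ρ, p, rfl, h6⟩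
    obtain ⟨rfl, rfl⟩ := pr_inj.1 h8
    exact (hc1 _).2 ⟨σ', h7, hf _ _ _ h1' h2 ((key _ _).2 ⟨_, h5, h9⟩)⟩
end Truth
end CtmForcing

namespace CtmForcing
open FirstOrder FirstOrder.Language

noncomputable section Poset
variable {W : Type*} [SetLang.Structure W] [Z : ZFW W]

theorem mem_asymm {x y : W} (h : x ∊ y) (h' : y ∊ x) : False := Z.wf.asymmetric _ _ h h'

/-- adjoining an element -/
def adj (s k : W) : W := un (up s (up k k))
theorem mem_adj (s k x : W) : x ∊ adj s k ↔ x ∊ s ∨ x = k := by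
  simp [adj, mem_un, mem_up]

theorem exists_poset : ∃ A : FP W, ∀ p, p ∊ A.P → ∃ q r, A.le q p ∧ A.le r p ∧
    ∀ t, A.le t q → A.le t r → False := by
  obtain ⟨I, ⟨e, h1, h2⟩, h3⟩ := Z.inf
  obtain ⟨P, hP'⟩ := sep (fun s => ∃ k, k ∊ I ∧ Sb s k) (pw (un I))
  have hP : ∀ s, s ∊ P ↔ ∃ k, k ∊ I ∧ Sb s k := by
    intro s
    refine (hP' s).trans ⟨fun h => h.2, fun h => ⟨?_, h⟩⟩
    obtain ⟨k, h4, h5⟩ := h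
    rw [mem_pw]; intro z hz; rw [mem_un]; exact ⟨k, h4, h5 z hz⟩
  refine ⟨{ P := P, le := fun t s => t ∊ P ∧ s ∊ P ∧ Sb s t ∧ ∀ a, a ∊ t → ¬ a ∊ s → ∀ b, b ∊ s → b ∊ a
            one := e, dle := inferInstance, memP := fun h => ⟨h.1, h.2.1⟩
            refl := fun h => ⟨h, h, fun _ h => h, fun a h h' => (h' h).elim⟩
            trans := ?_, top := ?_, oneP := (hP e).2 ⟨e, h1, fun _ h => h⟩ }, ?_⟩
  · rintro p q r ⟨a1, a2, a3, a4⟩ ⟨b1, b2, b3, b4⟩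
    refine ⟨a1, b2, fun z hz => a3 z (b3 z hz), fun a ha ha' b hb => ?_⟩
    by_cases haq : a ∊ q
    · exact b4 a haq ha' b hb
    · exact a4 a ha haq b (b3 b hb)
  · intro p hp
    exact ⟨hp, (hP e).2 ⟨e, h1, fun _ h => h⟩, fun z hz => (h2 z hz).elim,
      fun a _ _ b hb => (h2 b hb).elim⟩
  · intro s hs
    obtain ⟨k, hk, hsk⟩ := (hP s).1 hs
    obtain ⟨k', hk', e1⟩ := h3 k hk
    obtain ⟨k'', hk'', e2⟩ := h3 k' hk'
    refine ⟨adj s k, adj s k', ⟨(hP _).2 ⟨k', hk', ?_⟩, hs, ?_, ?_⟩, ⟨(hP _).2 ⟨k'', hk'', ?_⟩, hs, ?_, ?_⟩, ?_⟩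
    · intro z hz; rw [mem_adj] at hz; rw [e1]
      exact hz.imp (hsk z) id
    · intro z hz; exact (mem_adj _ _ _).2 (Or.inl hz)
    · intro a ha ha' b hb
      rcases (mem_adj _ _ _).1 ha with h | rfl
      · exact (ha' h).elim
      · exact hsk b hb
    · intro z hz; rw [mem_adj] at hz; rw [e2, e1]
      exact hz.imp (fun h => Or.inl (hsk z h)) id
    · intro z hz; exact (mem_adj _ _ _).2 (Or.inl hz)
    · intro a ha ha' b hb
      rcases (mem_adj _ _ _).1 ha with h | rfl
      · exact (ha' h).elim
      · exact (e1 _).2 (Or.inl (hsk b hb))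
    · rintro t ⟨-, -, a3, -⟩ ⟨-, -, -, b4⟩
      have hkk : k ∊ k' := (e1 _).2 (Or.inr rfl)
      have := b4 k (a3 k ((mem_adj _ _ _).2 (Or.inr rfl))) (fun h => by
        rcases (mem_adj _ _ _).1 h with h | h
        · exact mem_asymm (hsk _ h) (hsk _ h)
        · rw [← h] at hkk; exact mem_asymm hkk hkk) k' ((mem_adj _ _ _).2 (Or.inr rfl))
      exact mem_asymm this hkk

theorem exists_gen [Countable W] (A : FP W) : ∃ G, IsGen A G := by
  classical
  have : Nonempty W := ⟨A.one⟩
  obtain ⟨e, he⟩ := exists_surjective_nat W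
  let p : ℕ → {p : W // p ∊ A.P} := fun n => Nat.rec ⟨A.one, A.oneP⟩ (fun n p =>
    if h : ∃ q, q ∊ e n ∧ A.le q p.1 then ⟨h.choose, (A.memP h.choose_spec.2).1⟩ else p) n
  have hp : ∀ n, p (n+1) = if h : ∃ q, q ∊ e n ∧ A.le q (p n).1 then
    ⟨h.choose, (A.memP h.choose_spec.2).1⟩ else p n := fun n => rfl
  have mono : ∀ n k, A.le (p (n + k)).1 (p n).1 := by
    intro n k
    induction k with
    | zero => exact A.refl (p n).2
    | succ k ih =>
      refine A.trans ?_ ih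
      rw [← add_assoc, hp]
      split_ifs with h
      · exact h.choose_spec.2
      · exact A.refl (p _).2
  refine ⟨fun q => ∃ n, A.le (p n).1 q, ?_, ⟨0, A.refl A.oneP⟩, ?_, ?_, ?_⟩
  · rintro q ⟨n, h⟩; exact (A.memP h).2
  · rintro q r ⟨n, h⟩ h'; exact ⟨n, A.trans h h'⟩
  · rintro q r ⟨n, h⟩ ⟨m, h'⟩
    refine ⟨(p (n+m)).1, ⟨n+m, A.refl (p _).2⟩, A.trans (mono n m) h, ?_⟩
    rw [add_comm n m]; exact A.trans (mono m n) h'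
  · intro D hD
    obtain ⟨n, rfl⟩ := he D
    have h : ∃ q, q ∊ e n ∧ A.le q (p n).1 := hD _ (p n).2
    refine ⟨(p (n+1)).1, ⟨n+1, A.refl (p (n+1)).2⟩, ?_⟩
    rw [hp, dif_pos h]
    exact h.choose_spec.1

variable {A : FP W} {G : W → Prop}
theorem gen_not_mem (hG : IsGen A G) (hs : ∀ p, p ∊ A.P → ∃ q r, A.le q p ∧ A.le r p ∧
    ∀ t, A.le t q → A.le t r → False) (d : W) (hd : ∀ p, p ∊ d ↔ G p) : False := by
  obtain ⟨q, h1, h2⟩ := hG.dfn (fun p => ¬ p ∊ d) (fun p hp => by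
    obtain ⟨q, r, a, b, c⟩ := hs p hp
    by_cases hq : q ∊ d
    · refine ⟨r, fun hr => ?_, b⟩
      obtain ⟨t, -, h1, h2⟩ := hG.dir ((hd _).1 hq) ((hd _).1 hr)
      exact c t h1 h2
    · exact ⟨q, hq, a⟩)
  exact h2 ((hd q).2 h1)

/-- ordinals of the structure -/
def OrdW {V : Type*} [SetLang.Structure V] (a : V) : Prop :=
  (∀ y, y ∊ a → Sb y a) ∧ ∀ y, y ∊ a → ∀ z, z ∊ y → Sb z y
instance (f : (ℕ → W) → W) [DF f] : Dfn (fun v => OrdW (f v)) := by unfold OrdW; infer_instance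

/-- surjections -/
def FuncW (a b f : W) : Prop := ((∀ z, z ∊ f → ∃ x y, (x ∊ a ∧ y ∊ b) ∧ z = pr x y) ∧
  ∀ x, x ∊ a → ∃ y, y ∊ b ∧ pr x y ∊ f) ∧ ((∀ x y y', (pr x y ∊ f ∧ pr x y' ∊ f) → y = y') ∧
  ∀ y, y ∊ b → ∃ x, x ∊ a ∧ pr x y ∊ f)

theorem rk_lt {x y : W} (h : x ∊ y) : rkW x < rkW y := rkW_le.1 le_rfl x h
theorem rk_dm {x y : W} (h : y ∊ dm x) : rkW y < rkW x := by
  obtain ⟨s, hs⟩ := (mem_dm _ _).1 h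
  refine (rk_lt (y := up y y) ?_).trans ((rk_lt (y := pr y s) ?_).trans (rk_lt hs)) <;> simp [mem_up, pr]
end Poset

noncomputable section ExtLemmas
universe u
variable {W U : Type u} [SetLang.Structure W] [Z : ZFW W] [SetLang.Structure U] [ZU : ZFW U]
  {A : FP W} {G : W → Prop} {nv : W → U}

theorem rk_nv (hN : IsNv A G nv) (x : W) : rkW (nv x) ≤ rkW x := by
  induction x using (wf_dm (W := W)).induction with
  | _ x ih =>
    rw [rkW_le]; intro y hy
    obtain ⟨ρ, p, -, h, rfl⟩ := (hN.mem _ _).1 hy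
    have : ρ ∊ dm x := (mem_dm _ _).2 ⟨_, h⟩
    exact (ih _ this).trans_lt (rk_dm this)

variable {H : W → W}
theorem rk_chk (hN : IsNv A G nv) (hH : ∀ x z, z ∊ H x ↔ ∃ y, y ∊ x ∧ z = pr (H y) A.one) (x : W) :
    rkW x ≤ rkW (nv (H x)) := by
  induction x using Z.wf.induction with
  | _ x ih =>
    rw [rkW_le]; intro y hy
    exact (ih _ hy).trans_lt (rk_lt ((nv_chk hN hH _ _).2 ⟨y, hy, rfl⟩))

theorem chk_inj (hN : IsNv A G nv) (hH : ∀ x z, z ∊ H x ↔ ∃ y, y ∊ x ∧ z = pr (H y) A.one) (x : W) :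
    ∀ y, nv (H x) = nv (H y) → x = y := by
  have hk := nv_chk hN hH
  induction x using Z.wf.induction with
  | _ x ih =>
    intro y e
    apply Z.ext; intro z
    constructor
    · intro hz
      have : nv (H z) ∊ nv (H y) := by rw [← e, hk]; exact ⟨z, hz, rfl⟩
      obtain ⟨z', h1, h2⟩ := (hk _ _).1 this
      rw [ih z hz z' h2]; exact h1
    · intro hz
      have : nv (H z) ∊ nv (H x) := by rw [e, hk]; exact ⟨z, hz, rfl⟩
      obtain ⟨z', h1, h2⟩ := (hk _ _).1 this
      rw [← ih z' h1 z h2.symm]; exact h1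

/-- pair names -/
def upn (A : FP W) (a b : W) : W := up (pr a A.one) (pr b A.one)
theorem nv_upn (hN : IsNv A G nv) (a b : W) : nv (upn A a b) = up (nv a) (nv b) := by
  apply ZU.ext; intro z
  rw [hN.mem, mem_up]
  constructor
  · rintro ⟨ρ, p, -, h, rfl⟩
    rcases (mem_up _ _ _).1 h with h | h <;> obtain ⟨rfl, rfl⟩ := pr_inj.1 h <;> simp
  · rintro (rfl | rfl)
    · exact ⟨_, _, hN.gen.one, (mem_up _ _ _).2 (Or.inl rfl), rfl⟩
    · exact ⟨_, _, hN.gen.one, (mem_up _ _ _).2 (Or.inr rfl), rfl⟩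
/-- ordered pair names -/
def opn (A : FP W) (a b : W) : W := upn A (upn A a a) (upn A a b)
theorem nv_opn (hN : IsNv A G nv) (a b : W) : nv (opn A a b) = pr (nv a) (nv b) := by
  simp only [opn, nv_upn hN, pr]

theorem ac_ext (hN : IsNv A G nv) (hAC : ∀ x : W, ∃ a f, OrdW a ∧ FuncW a x f) (x : U) :
    ∃ a f, OrdW a ∧ FuncW a x f := by
  obtain ⟨H, iH', hH⟩ := exists_chk A.one
  have iH : ∀ f [DF f], DF (fun v : ℕ → W => H (f v)) := fun f _ => iH'.comp1 f
  have hk := nv_chk hN hH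
  by_cases hx : ∃ y, y ∊ x
  swap
  · refine ⟨x, x, ⟨fun y hy => (hx ⟨y, hy⟩).elim, fun y hy => (hx ⟨y, hy⟩).elim⟩,
      ⟨fun y hy => (hx ⟨y, hy⟩).elim, fun y hy => (hx ⟨y, hy⟩).elim⟩,
      fun a b c h => (hx ⟨_, h.1⟩).elim, fun y hy => (hx ⟨y, hy⟩).elim⟩
  obtain ⟨y0, hy0⟩ := hx
  obtain ⟨τ, rfl⟩ := hN.surj x
  obtain ⟨α, f, hα, hf⟩ := hAC (dm τ)
  have iO : DF (fun v : ℕ → W => opn A (v 0) (v 1)) := by unfold opn upn; infer_instance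
  have iO' : ∀ f g [DF f] [DF g], DF (fun v : ℕ → W => opn A (f v) (g v)) := fun f g _ _ => iO.comp2 f g
  obtain ⟨b, hb⟩ := repl (fun u z => ∃ β ρ : W, u = pr β ρ ∧ z = opn A (H β) ρ) f (by
    rintro u _ _ - ⟨β, ρ, rfl, rfl⟩ ⟨β', ρ', e, rfl⟩
    obtain ⟨rfl, rfl⟩ := pr_inj.1 e; rfl)
  obtain ⟨g', hg'⟩ := star hN b
  have hg : ∀ u w, pr u w ∊ nv g' ↔ ∃ β ρ, pr β ρ ∊ f ∧ u = nv (H β) ∧ w = nv ρ := by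
    intro u w; rw [hg']
    constructor
    · rintro ⟨σ, h1, h2⟩
      obtain ⟨_, h3, β, ρ, rfl, rfl⟩ := (hb _).1 h1
      rw [nv_opn hN, pr_inj] at h2
      exact ⟨β, ρ, h3, h2⟩
    · rintro ⟨β, ρ, h1, rfl, rfl⟩
      exact ⟨_, (hb _).2 ⟨_, h1, β, ρ, rfl, rfl⟩, (nv_opn hN _ _).symm⟩
  obtain ⟨h, hh'⟩ := sep (fun z => ∃ β y : U, z = pr β y ∧ (pr β y ∊ nv g' ∨
    (y = y0 ∧ ∀ y', y' ∊ nv τ → ¬ pr β y' ∊ nv g'))) (prd (nv (H α)) (nv τ))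
  have hh : ∀ β y, pr β y ∊ h ↔ (β ∊ nv (H α) ∧ y ∊ nv τ) ∧ (pr β y ∊ nv g' ∨
    (y = y0 ∧ ∀ y', y' ∊ nv τ → ¬ pr β y' ∊ nv g')) := by
    intro β y; rw [hh', mem_prd]
    refine and_congr ⟨?_, ?_⟩ ⟨?_, ?_⟩
    · rintro ⟨β', y', h1, h2, e⟩; obtain ⟨rfl, rfl⟩ := pr_inj.1 e; exact ⟨h1, h2⟩
    · rintro ⟨h1, h2⟩; exact ⟨_, _, h1, h2, rfl⟩
    · rintro ⟨β', y', e, h⟩; obtain ⟨rfl, rfl⟩ := pr_inj.1 e; exact h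
    · intro h; exact ⟨_, _, rfl, h⟩
  refine ⟨nv (H α), h, ⟨?_, ?_⟩, ⟨?_, ?_⟩, ?_, ?_⟩
  · intro y hy z hz
    obtain ⟨y, h1, rfl⟩ := (hk _ _).1 hy
    obtain ⟨z, h2, rfl⟩ := (hk _ _).1 hz
    exact (hk _ _).2 ⟨z, hα.1 y h1 z h2, rfl⟩
  · intro y hy z hz w hw
    obtain ⟨y, h1, rfl⟩ := (hk _ _).1 hy
    obtain ⟨z, h2, rfl⟩ := (hk _ _).1 hz
    obtain ⟨w, h3, rfl⟩ := (hk _ _).1 hw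
    exact (hk _ _).2 ⟨w, hα.2 y h1 z h2 w h3, rfl⟩
  · intro z hz
    obtain ⟨u, w, h1, h2, h3⟩ := (mem_prd _ _ _).1 ((hh' _).1 hz).1
    exact ⟨u, w, ⟨h1, h2⟩, h3⟩
  · intro β hβ
    by_cases hc : ∃ y, y ∊ nv τ ∧ pr β y ∊ nv g'
    · obtain ⟨y, h1, h2⟩ := hc
      exact ⟨y, h1, (hh _ _).2 ⟨⟨hβ, h1⟩, Or.inl h2⟩⟩
    · push Not at hc
      exact ⟨y0, hy0, (hh _ _).2 ⟨⟨hβ, hy0⟩, Or.inr ⟨rfl, hc⟩⟩⟩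
  · rintro β y y' ⟨h1, h2⟩
    obtain ⟨⟨-, a1⟩, b1⟩ := (hh _ _).1 h1
    obtain ⟨⟨-, a2⟩, b2⟩ := (hh _ _).1 h2
    rcases b1 with b1 | ⟨b1, c1⟩ <;> rcases b2 with b2 | ⟨b2, c2⟩
    · obtain ⟨β1, ρ1, k1, rfl, rfl⟩ := (hg _ _).1 b1
      obtain ⟨β2, ρ2, k2, e, rfl⟩ := (hg _ _).1 b2
      obtain rfl := chk_inj hN hH _ _ e
      rw [hf.2.1 _ _ _ ⟨k1, k2⟩]
    · exact (c2 _ a1 b1).elim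
    · exact (c1 _ a2 b2).elim
    · rw [b1, b2]
  · intro y hy
    have hy' := hy
    obtain ⟨ρ, p, -, h1, rfl⟩ := (hN.mem _ _).1 hy
    obtain ⟨β, h2, h3⟩ := hf.2.2 ρ ((mem_dm _ _).2 ⟨_, h1⟩)
    have h4 := (hk α _).2 ⟨β, h2, rfl⟩
    exact ⟨_, h4, (hh _ _).2 ⟨⟨h4, hy'⟩, Or.inl ((hg _ _).2 ⟨β, ρ, h3, rfl, rfl⟩)⟩⟩

theorem gen_name (hN : IsNv A G nv)
    (iH' : DF (fun v : ℕ → W => H (v 0))) : ∃ γ : U, ∀ z, z ∊ γ ↔ ∃ p, G p ∧ z = nv (H p) := by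
  have iH : ∀ f [DF f], DF (fun v : ℕ → W => H (f v)) := fun f _ => iH'.comp1 f
  obtain ⟨c, hc⟩ := exists_image (fun p => pr (H p) p) A.P
  refine ⟨nv c, fun z => (hN.mem _ _).trans ?_⟩
  constructor
  · rintro ⟨ρ, p, h1, h2, rfl⟩
    obtain ⟨σ, h3, h4⟩ := (hc _).1 h2
    obtain ⟨rfl, rfl⟩ := pr_inj.1 h4
    exact ⟨_, h1, rfl⟩
  · rintro ⟨p, h1, rfl⟩
    exact ⟨_, _, h1, (hc _).2 ⟨p, hN.gen.sub h1, rfl⟩, rfl⟩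

/-- every bound on ranks is realized by an ordinal -/
theorem exists_ord (x : W) : ∃ o : W, ∀ y, y ∊ o ↔ rkW y < rkW x ∧ OrdW y := by
  obtain ⟨H, -, h2⟩ := exists_hier (W := W)
  obtain ⟨o, ho⟩ := sep (fun y : W => OrdW y) (H x)
  exact ⟨o, fun y => by rw [ho, mem_hier h2]⟩
end ExtLemmas
end CtmForcing

namespace CtmForcing
open FirstOrder FirstOrder.Language

section Sem
variable {W : Type*} [SetLang.Structure W]

theorem sub_iff (v : Fin 2 → W) : Rz subF v ↔ Sb (v 0) (v 1) := by
  unfold subF; simp only [Rz_all, Rz_imp, Rz_mem]; exact Iff.rfl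
theorem empty_iff (v : Fin 1 → W) : Rz emptyF v ↔ ∀ x, ¬ x ∊ v 0 := by
  unfold emptyF; simp only [Rz_all, Rz_not, Rz_mem]; exact Iff.rfl
theorem pairSet_iff (v : Fin 3 → W) : Rz pairSetF v ↔ ∀ x, x ∊ v 2 ↔ x = v 0 ∨ x = v 1 := by
  unfold pairSetF; simp only [Rz_all, Rz_iff, Rz_or, Rz_eq, Rz_mem]; exact Iff.rfl
theorem sing_iff (v : Fin 2 → W) : Rz singF v ↔ ∀ x, x ∊ v 1 ↔ x = v 0 ∨ x = v 0 := by
  unfold singF; rw [Rz_re, pairSet_iff]; exact Iff.rfl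
theorem succ_iff (v : Fin 2 → W) : Rz succF v ↔ ∀ x, x ∊ v 1 ↔ x ∊ v 0 ∨ x = v 0 := by
  unfold succF; simp only [Rz_all, Rz_iff, Rz_or, Rz_eq, Rz_mem]; exact Iff.rfl
theorem trans_iff (v : Fin 1 → W) : Rz transF v ↔ ∀ y, y ∊ v 0 → Sb y (v 0) := by
  unfold transF; simp only [Rz_all, Rz_imp, Rz_re, sub_iff, Rz_mem]; exact Iff.rfl
theorem ord_iff (v : Fin 1 → W) : Rz ordF v ↔ OrdW (v 0) := by
  unfold ordF; simp only [Rz_all, Rz_imp, Rz_re, Rz_and, trans_iff, Rz_mem]; exact Iff.rfl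
theorem op_iff [Z : ZFW W] (v : Fin 3 → W) : Rz opF v ↔ v 2 = pr (v 0) (v 1) := by
  unfold opF; simp only [Rz_all, Rz_iff, Rz_or, Rz_re, Rz_mem, sing_iff, pairSet_iff]
  have key : ∀ a b x : W, (∀ y, y ∊ x ↔ y = a ∨ y = b) ↔ x = up a b := by
    intro a b x
    constructor
    · intro h; apply Z.ext; intro y; rw [h, mem_up]
    · rintro rfl y; exact mem_up _ _ _
  have : (∀ x, x ∊ v 2 ↔ (∀ y, y ∊ x ↔ y = v 0 ∨ y = v 0) ∨ (∀ y, y ∊ x ↔ y = v 0 ∨ y = v 1)) ↔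
      v 2 = pr (v 0) (v 1) := by
    simp only [key]; exact Iff.rfl
  exact this
theorem relMem_iff [Z : ZFW W] (v : Fin 3 → W) : Rz relMemF v ↔ pr (v 0) (v 1) ∊ v 2 := by
  unfold relMemF; simp only [Rz_ex, Rz_and, Rz_re, op_iff, Rz_mem]
  have : (∃ z, z = pr (v 0) (v 1) ∧ z ∊ v 2) ↔ pr (v 0) (v 1) ∊ v 2 := by simp
  exact this
theorem func_iff [Z : ZFW W] (v : Fin 3 → W) : Rz isFuncF v ↔ FuncW (v 0) (v 1) (v 2) := by
  unfold isFuncF; simp only [Rz_ex, Rz_all, Rz_imp, Rz_eq, Rz_and, Rz_re, op_iff, relMem_iff, Rz_mem]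
  exact Iff.rfl

theorem real_iff (φ : SetLang.Sentence) : Sentence.Realize W φ ↔ Rz (φ : BF 0) (default : Fin 0 → W) :=
  Iff.rfl

theorem ext_iff' : Sentence.Realize W extAx ↔ ∀ x y : W, (Sb x y ∧ Sb y x) → x = y := by
  rw [real_iff]; unfold extAx; simp only [Rz_all, Rz_imp, Rz_and, Rz_re, sub_iff, Rz_eq]; exact Iff.rfl
theorem found_iff : Sentence.Realize W foundAx ↔ ∀ x : W, (∃ y, y ∊ x) → ∃ y, y ∊ x ∧
    ∀ z, z ∊ x → ¬ z ∊ y := by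
  rw [real_iff]; unfold foundAx; simp only [Rz_all, Rz_ex, Rz_not, Rz_imp, Rz_and, Rz_mem]; exact Iff.rfl
theorem pair_iff : Sentence.Realize W pairAx ↔ ∀ a b : W, ∃ c, ∀ x, x ∊ c ↔ x = a ∨ x = b := by
  rw [real_iff]; unfold pairAx; simp only [Rz_all, Rz_ex, pairSet_iff]; exact Iff.rfl
theorem union_iff : Sentence.Realize W unionAx ↔ ∀ a : W, ∃ c, ∀ x, x ∊ c ↔ ∃ y, y ∊ a ∧ x ∊ y := by
  rw [real_iff]; unfold unionAx; simp only [Rz_all, Rz_ex, Rz_iff, Rz_and, Rz_mem]; exact Iff.rfl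
theorem pow_iff : Sentence.Realize W powAx ↔ ∀ a : W, ∃ c, ∀ x, x ∊ c ↔ Sb x a := by
  rw [real_iff]; unfold powAx powF; simp only [Rz_all, Rz_ex, Rz_iff, Rz_re, sub_iff, Rz_mem]; exact Iff.rfl
theorem inf_iff : Sentence.Realize W infAx ↔ ∃ I : W, (∃ e, e ∊ I ∧ ∀ x, ¬ x ∊ e) ∧
    ∀ k, k ∊ I → ∃ k', k' ∊ I ∧ ∀ x, x ∊ k' ↔ x ∊ k ∨ x = k := by
  rw [real_iff]; unfold infAx
  simp only [Rz_all, Rz_ex, Rz_imp, Rz_and, Rz_re, empty_iff, succ_iff, Rz_mem]; exact Iff.rfl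
theorem ac_iff [Z : ZFW W] : Sentence.Realize W acAx ↔ ∀ x : W, ∃ a f, OrdW a ∧ FuncW a x f := by
  rw [real_iff]; unfold acAx
  simp only [Rz_all, Rz_ex, Rz_and, Rz_re, ord_iff, func_iff]; exact Iff.rfl

theorem alls_iff {n : ℕ} (φ : BF n) : Sentence.Realize W (φ.alls : SetLang.Sentence) ↔
    ∀ c : Fin n → W, Rz φ c := by
  unfold Sentence.Realize
  rw [BoundedFormula.realize_alls]; rfl

theorem snoc_lt {n : ℕ} (c : Fin n → W) (x : W) (i : ℕ) (h : i < n) (h' : i < n + 1) :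
    (Fin.snoc c x : Fin (n+1) → W) ⟨i, h'⟩ = c ⟨i, h⟩ := by
  simp [Fin.snoc, h]
theorem snoc_eq {n : ℕ} (c : Fin n → W) (x : W) (h' : n < n + 1) :
    (Fin.snoc c x : Fin (n+1) → W) ⟨n, h'⟩ = x := by
  simp [Fin.snoc]

theorem sep_iff {n : ℕ} (φ : BF (n+1)) : Sentence.Realize W (sepAx φ) ↔ ∀ (c : Fin n → W) (a : W),
    ∃ b, ∀ x, x ∊ b ↔ x ∊ a ∧ Rz φ (Fin.snoc c x : Fin (n+1) → W) := by
  unfold sepAx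
  dsimp only
  rw [alls_iff]
  simp only [Rz_all, Rz_ex, Rz_iff, Rz_and, Rz_re, Rz_mem]
  refine forall_congr' fun c => forall_congr' fun a => exists_congr fun b => forall_congr' fun x => ?_
  refine iff_congr ?_ (and_congr ?_ (iff_of_eq ?_))
  · rw [snoc_eq, snoc_lt _ _ _ (by omega), snoc_eq]
  · rw [snoc_eq, snoc_lt _ _ _ (by omega), snoc_lt _ _ _ (by omega), snoc_eq]
  · congr 1; funext i
    refine Fin.lastCases ?_ (fun j => ?_) i
    · simp [snoc_eq]
    · have := j.2
      simp only [Fin.val_castSucc, this, dif_pos, Fin.snoc_castSucc]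
      rw [snoc_lt _ _ _ (by omega), snoc_lt _ _ _ (by omega), snoc_lt _ _ _ this]

theorem repl_iff {n : ℕ} (φ : BF (n+2)) : Sentence.Realize W (replAx φ) ↔ ∀ (c : Fin n → W) (a : W),
    (∀ x y y', x ∊ a → Rz φ (Fin.snoc (Fin.snoc c x : Fin (n+1) → W) y : Fin (n+2) → W) →
      Rz φ (Fin.snoc (Fin.snoc c x : Fin (n+1) → W) y' : Fin (n+2) → W) → y = y') →
    ∃ b, ∀ y, y ∊ b ↔ ∃ x, x ∊ a ∧
      Rz φ (Fin.snoc (Fin.snoc c x : Fin (n+1) → W) y : Fin (n+2) → W) := by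
  unfold replAx
  dsimp only
  rw [alls_iff]
  simp only [Rz_all, Rz_ex, Rz_iff, Rz_imp, Rz_and, Rz_re, Rz_mem, Rz_eq]
  refine forall_congr' fun c => forall_congr' fun a => imp_congr ?_ ?_
  · refine forall_congr' fun x => forall_congr' fun y => forall_congr' fun y' => ?_
    rw [and_imp, and_imp]
    refine imp_congr ?_ (imp_congr (iff_of_eq ?_) (imp_congr (iff_of_eq ?_) ?_))
    · rw [snoc_lt _ _ _ (by omega), snoc_lt _ _ _ (by omega), snoc_eq, snoc_lt _ _ _ (by omega),
        snoc_lt _ _ _ (by omega), snoc_lt _ _ _ (by omega), snoc_eq]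
    · congr 1; funext i
      refine Fin.lastCases ?_ (fun j => Fin.lastCases ?_ (fun j => ?_) j) i
      · simp [snoc_eq, snoc_lt]
      · simp [snoc_eq, snoc_lt]
      · have := j.2
        simp only [Fin.val_castSucc, this, dif_pos, Fin.snoc_castSucc]
        rw [snoc_lt _ _ _ (by omega), snoc_lt _ _ _ (by omega), snoc_lt _ _ _ (by omega),
          snoc_lt _ _ _ this]
    · congr 1; funext i
      refine Fin.lastCases ?_ (fun j => Fin.lastCases ?_ (fun j => ?_) j) i
      · simp [snoc_eq, snoc_lt]
      · simp [snoc_eq, snoc_lt]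
      · have := j.2
        simp only [Fin.val_castSucc, this, dif_pos, Fin.snoc_castSucc]
        rw [snoc_lt _ _ _ (by omega), snoc_lt _ _ _ (by omega), snoc_lt _ _ _ (by omega),
          snoc_lt _ _ _ this]
    · rw [snoc_lt _ _ _ (by omega), snoc_eq, snoc_eq]
  · refine exists_congr fun b => forall_congr' fun y => iff_congr ?_ (exists_congr fun x =>
      and_congr ?_ (iff_of_eq ?_))
    · rw [snoc_eq, snoc_lt _ _ _ (by omega), snoc_eq]
    · rw [snoc_eq, snoc_lt _ _ _ (by omega), snoc_lt _ _ _ (by omega), snoc_lt _ _ _ (by omega), snoc_eq]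
    · congr 1; funext i
      refine Fin.lastCases ?_ (fun j => Fin.lastCases ?_ (fun j => ?_) j) i
      · simp [snoc_eq, snoc_lt]
      · simp [snoc_eq, snoc_lt]
      · have := j.2
        simp only [Fin.val_castSucc, this, dif_pos, Fin.snoc_castSucc]
        rw [snoc_lt _ _ _ (by omega), snoc_lt _ _ _ (by omega), snoc_lt _ _ _ (by omega),
          snoc_lt _ _ _ this]

theorem zfw_of (hext : ∀ x y : W, (∀ z, z ∊ x ↔ z ∊ y) → x = y) (hwf : WellFounded (Mm : W → W → Prop))
    (h : ∀ φ ∈ ZF, Sentence.Realize W φ) : ZFW W where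
  ext := hext
  wf := hwf
  pair := pair_iff.1 (h _ (by simp [ZF, Z, zfFin]))
  union := union_iff.1 (h _ (by simp [ZF, Z, zfFin]))
  pow := pow_iff.1 (h _ (by simp [ZF, Z, zfFin]))
  inf := inf_iff.1 (h _ (by simp [ZF, Z, zfFin]))
  sepA n φ := (sep_iff φ).1 (h _ (Or.inl (Or.inr ⟨⟨n, φ⟩, rfl⟩)))
  replA n φ := (repl_iff φ).1 (h _ (Or.inr ⟨⟨n, φ⟩, rfl⟩))

theorem zfw_real [Zi : ZFW W] : ∀ φ ∈ ZF, Sentence.Realize W φ := by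
  rintro φ ((h | ⟨⟨n, φ⟩, rfl⟩) | ⟨⟨n, φ⟩, rfl⟩)
  · simp only [zfFin, Set.mem_insert_iff, Set.mem_singleton_iff] at h
    rcases h with rfl | rfl | rfl | rfl | rfl | rfl
    · exact ext_iff'.2 fun x y h => Sb.antisymm h.1 h.2
    · refine found_iff.2 fun x hx => ?_
      obtain ⟨m, h1, h2⟩ := Zi.wf.has_min {y | y ∊ x} hx
      exact ⟨m, h1, h2⟩
    · exact pair_iff.2 Zi.pair
    · exact union_iff.2 Zi.union
    · exact pow_iff.2 Zi.pow
    · exact inf_iff.2 Zi.inf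
  · exact (sep_iff φ).2 (Zi.sepA n φ)
  · exact (repl_iff φ).2 (Zi.replA n φ)
end Sem
end CtmForcing

namespace CtmForcing

open FirstOrder FirstOrder.Language

section Final
universe v

/-- elements of a set as a structure -/
abbrev El (M : ZFSet.{v}) := {x : ZFSet.{v} // x ∈ M}

instance (M : ZFSet.{v}) : SetLang.Structure (El M) := zfStruct M

theorem El_mem {M : ZFSet.{v}} (x y : El M) : x ∊ y ↔ x.1 ∈ y.1 := Iff.rfl

theorem El_ext {M : ZFSet.{v}} (hM : M.IsTransitive) (x y : El M) (h : ∀ z, z ∊ x ↔ z ∊ y) :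
    x = y := by
  apply Subtype.ext
  apply ZFSet.ext
  intro z
  constructor
  · intro hz; exact (h ⟨z, hM _ x.2 hz⟩).1 hz
  · intro hz; exact (h ⟨z, hM _ y.2 hz⟩).2 hz

theorem El_wf {M : ZFSet.{v}} : WellFounded (Mm : El M → El M → Prop) :=
  InvImage.wf (fun x : El M => x.1) ZFSet.mem_wf

theorem exists_val {M : ZFSet.{v}} [ZFW (El M)] (G : El M → Prop) :
    ∃ val : El M → ZFSet.{v}, ∀ x z, z ∈ val x ↔ ∃ ρ p, G p ∧ pr ρ p ∊ x ∧ z = val ρ := by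
  classical
  let F : (x : El M) → ((y : El M) → y ∊ dm x → ZFSet.{v}) → ZFSet.{v} := fun x f =>
    ZFSet.range (fun y : {y : El M // y ∊ dm x ∧ ∃ p, G p ∧ pr y p ∊ x} => f y.1 y.2.1)
  refine ⟨(wf_dm (W := El M)).fix F, fun x z => ?_⟩
  rw [WellFounded.fix_eq]
  simp only [F, ZFSet.mem_range]
  constructor
  · rintro ⟨⟨y, hy, p, hp, h⟩, rfl⟩
    exact ⟨y, p, hp, h, rfl⟩
  · rintro ⟨ρ, p, hp, h, rfl⟩
    exact ⟨⟨ρ, (mem_dm _ _).2 ⟨p, h⟩, p, hp, h⟩, rfl⟩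

theorem isOrd_iff (x : ZFSet.{v}) : IsOrd x ↔ x.IsOrdinal := by
  rw [ZFSet.isOrdinal_iff_forall_mem_isTransitive]; exact Iff.rfl

theorem OrdW_iff {M : ZFSet.{v}} (hM : M.IsTransitive) (x : El M) : OrdW x ↔ IsOrd x.1 := by
  constructor
  · rintro ⟨h1, h2⟩
    refine ⟨fun y hy z hz => ?_, fun y hy z hz t ht => ?_⟩
    · exact h1 ⟨y, hM _ x.2 hy⟩ hy ⟨z, hM _ (hM _ x.2 hy) hz⟩ hz
    · have a := hM _ x.2 hy
      have b := hM _ a hz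
      exact h2 ⟨y, a⟩ hy ⟨z, b⟩ hz ⟨t, hM _ b ht⟩ ht
  · rintro ⟨h1, h2⟩
    exact ⟨fun y hy z hz => h1 y.1 hy hz, fun y hy z hz t ht => h2 y.1 hy z.1 hz ht⟩

theorem main_aux (M : ZFSet.{v}) (hcount : Countable (El M))
    (htrans : M.IsTransitive) (hmodel : ∀ φ ∈ ZF, Sentence.Realize (El M) φ) :
    ∃ N : ZFSet.{v}, M ⊆ N ∧ M ≠ N ∧ {x | x ∈ N}.Countable ∧ N.IsTransitive ∧
      (∀ α : ZFSet, IsOrd α → (α ∈ M ↔ α ∈ N)) ∧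
      (∀ φ ∈ ZF, Sentence.Realize (El N) φ) ∧
      (Sentence.Realize (El M) acAx → Sentence.Realize (El N) acAx) := by
  have ZM : ZFW (El M) := zfw_of (El_ext htrans) El_wf hmodel
  obtain ⟨A, hA⟩ := exists_poset (W := El M)
  obtain ⟨G, hG⟩ := exists_gen A
  obtain ⟨H, iH, hH⟩ := exists_chk A.one
  obtain ⟨val, hval⟩ := exists_val G
  let N : ZFSet.{v} := ZFSet.range val
  have hN : ∀ x, x ∈ N ↔ ∃ i, val i = x := fun x => ZFSet.mem_range
  have hNt : N.IsTransitive := by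
    intro y hy z hz
    obtain ⟨x, rfl⟩ := (hN _).1 hy
    obtain ⟨ρ, p, -, -, rfl⟩ := (hval _ _).1 hz
    exact (hN _).2 ⟨ρ, rfl⟩
  let nv : El M → El N := fun x => ⟨val x, (hN _).2 ⟨x, rfl⟩⟩
  have hnv : IsNv A G nv :=
    { gen := hG
      ext := El_ext hNt
      wf := El_wf
      surj := by
        rintro ⟨y, hy⟩
        obtain ⟨x, hx⟩ := (hN _).1 hy
        exact ⟨x, Subtype.ext hx⟩
      mem := by
        intro x z
        rw [El_mem, hval]
        simp only [nv, Subtype.ext_iff] }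
  have ZN : ZFW (El N) := ext_zfw hnv
  have hchk : ∀ x : El M, val (H x) = x.1 := by
    intro x
    induction x using (El_wf (M := M)).induction with
    | _ x ih =>
      have k := nv_chk hnv hH x
      apply ZFSet.ext
      intro z
      constructor
      · intro hz
        obtain ⟨y, hy, e⟩ := (k ⟨z, hNt _ (nv (H x)).2 hz⟩).1 hz
        have e' : z = val (H y) := congrArg Subtype.val e
        rw [e', ih y hy]; exact hy
      · intro hz
        have hz' := htrans _ x.2 hz
        have := (k (nv (H ⟨z, hz'⟩))).2 ⟨⟨z, hz'⟩, hz, rfl⟩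
        rw [El_mem] at this
        have e : (nv (H ⟨z, hz'⟩)).1 = z := ih ⟨z, hz'⟩ hz
        rw [e] at this
        exact this
  have hsub : M ⊆ N := fun x hx => (hN _).2 ⟨H ⟨x, hx⟩, hchk ⟨x, hx⟩⟩
  have hord : ∀ α : ZFSet, IsOrd α → α ∈ N → α ∈ M := by
    intro α
    induction α using ZFSet.inductionOn with
    | _ α ih =>
      intro ho hα
      obtain ⟨x, hx⟩ := (hN _).1 hα
      obtain ⟨o, hoo⟩ := exists_ord x
      have hoI : IsOrd o.1 := by
        rw [← OrdW_iff htrans]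
        refine ⟨fun y hy z hz => ?_, fun y hy => ((hoo _).1 hy).2.1⟩
        obtain ⟨a, b⟩ := (hoo _).1 hy
        refine (hoo _).2 ⟨(rk_lt hz).trans a, b.2 z hz, fun t ht s hs => ?_⟩
        have ht' := b.2 z hz t ht
        exact b.2 t (b.1 z hz t ht) s hs
      have hs : α ⊆ o.1 := by
        intro β hβ
        have hβo : IsOrd β := by
          refine ⟨ho.2 β hβ, fun t ht => ho.2 t (ho.1 β hβ ht)⟩
        have hβM := ih β hβ hβo (hNt _ hα hβ)
        refine (hoo ⟨β, hβM⟩).2 ⟨?_, (OrdW_iff htrans _).2 hβo⟩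
        refine (rk_chk hnv hH _).trans_lt ((rk_lt ?_).trans_le (rk_nv hnv x))
        rw [El_mem]
        change val (H ⟨β, hβM⟩) ∈ val x
        rw [hchk, hx]; exact hβ
      rcases (((isOrd_iff _).1 ho).subset_iff_eq_or_mem ((isOrd_iff _).1 hoI)).1 hs with h | h
      · rw [h]; exact o.2
      · exact htrans _ o.2 h
  refine ⟨N, hsub, ?_, ?_, hNt, fun α hα => ⟨fun h => hsub h, hord α hα⟩, zfw_real, ?_⟩
  · intro hMN
    obtain ⟨γ, hγ⟩ := gen_name hnv iH
    refine gen_not_mem hG hA ⟨γ.1, by rw [hMN]; exact γ.2⟩ fun p => ?_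
    have hp := hγ (nv (H p))
    rw [El_mem] at hp ⊢
    have e : (nv (H p)).1 = p.1 := hchk p
    rw [e] at hp
    rw [hp]
    constructor
    · rintro ⟨q, hq, e⟩
      have e' : val (H p) = val (H q) := congrArg Subtype.val e
      rw [hchk, hchk] at e'
      rwa [Subtype.ext e']
    · intro h; exact ⟨p, h, rfl⟩
  · refine (Set.countable_range val).mono ?_
    intro x hx; exact (hN _).1 hx
  · rw [ac_iff, ac_iff]
    exact ac_ext hnv

end Final

/-- a ctm of `ZF` has a proper countable transitive extension with the same
ordinals modelling `ZF`, which moreover models `AC` whenever the ground model does. -/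
theorem ctm_ZF_proper_extension (M : ZFSet) (hcount : M.toSet.Countable)
    (htrans : M.IsTransitive) (hmodel : ZModels M ZF) :
    ∃ N : ZFSet, M ⊆ N ∧ M ≠ N ∧ N.toSet.Countable ∧ N.IsTransitive ∧
      (∀ α : ZFSet, IsOrd α → (α ∈ M ↔ α ∈ N)) ∧
      ZModels N ZF ∧ (ZModels M {acAx} → ZModels N {acAx}) := by
  obtain ⟨N, h1, h2, h3, h4, h5, h6, h7⟩ := main_aux M hcount.to_subtype htrans hmodel
  refine ⟨N, h1, h2, h3, h4, h5, h6, fun h φ hφ => ?_⟩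
  have e : φ = acAx := hφ
  subst e
  exact h7 (h _ rfl)

end CtmForcing
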